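/- For all fixed integers ℓ ≥ r ≥ 1 there exists a constant C = C(ℓ,r) > 0 such that for every odd prime p and all integers H, N with 0 ≤ H < H + N < p, one has |I_ℓ(H,N) − N^{2ℓ}/(p−1)| ≤ C · N^{3ℓ/2 + r/2 − 1 + 2^{−r}} · p^{(ℓ−r)/4} · (log p)^{(ℓ−r)/2}. -/

import Mathlib

open Polynomial in
/-- Hasse derivatives of a power `h ^ e` are divisible by `h ^ (e - u)`, with a cofactor of
controlled degree. -/
theorem exists_hasseDeriv_pow_eq {K : Type*} [Field K] (h : K[X]) {m : ℕ}
    (hm : h.natDegree ≤ m) (e u : ℕ) :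
    ∃ s : K[X], s.natDegree ≤ u * m ∧ hasseDeriv u (h ^ e) = h ^ (e - u) * s := by
  induction e generalizing u with
  | zero =>
    refine ⟨hasseDeriv u (h ^ 0), ?_, by simp⟩
    refine (natDegree_hasseDeriv_le _ _).trans ?_
    simp
  | succ e ih =>
    rcases Nat.lt_or_ge e u with hu | hu
    · refine ⟨hasseDeriv u (h ^ (e + 1)), ?_, by simp [Nat.sub_eq_zero_of_le hu]⟩
      refine (natDegree_hasseDeriv_le _ _).trans ((Nat.sub_le _ _).trans ?_)
      refine natDegree_pow_le.trans ?_
      gcongr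
      exact hu
    · choose s hs hs' using ih
      refine ⟨∑ ab ∈ Finset.HasAntidiagonal.antidiagonal u,
        if ab.2 = 0 then s ab.1 else h ^ (ab.2 - 1) * s ab.1 * hasseDeriv ab.2 h, ?_, ?_⟩
      · refine natDegree_sum_le_of_forall_le _ _ fun ab hab => ?_
        rw [Finset.HasAntidiagonal.mem_antidiagonal] at hab
        split_ifs with hb
        · refine (hs _).trans ?_
          gcongr
          omega
        · refine natDegree_mul_le.trans ?_
          have h1 : (h ^ (ab.2 - 1) * s ab.1).natDegree ≤ (ab.2 - 1) * m + ab.1 * m := by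
            refine natDegree_mul_le.trans (add_le_add ?_ (hs _))
            refine natDegree_pow_le.trans ?_
            gcongr
          have h2 : (hasseDeriv ab.2 h).natDegree ≤ m :=
            (natDegree_hasseDeriv_le _ _).trans ((Nat.sub_le _ _).trans hm)
          have h3 : u * m = (ab.2 - 1) * m + ab.1 * m + m := by
            rw [← hab]
            obtain ⟨b, hb'⟩ := Nat.exists_eq_succ_of_ne_zero hb
            rw [hb']
            simp only [Nat.succ_eq_add_one, Nat.add_sub_cancel]
            ring
          omega
      · rw [pow_succ, hasseDeriv_mul, Finset.mul_sum]
        refine Finset.sum_congr rfl fun ab hab => ?_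
        rw [Finset.HasAntidiagonal.mem_antidiagonal] at hab
        rw [hs']
        split_ifs with hb
        · have h1 : e + 1 - u = (e - ab.1) + 1 := by omega
          rw [hb, h1, hasseDeriv_zero', pow_succ]
          ring
        · have h1 : e - ab.1 = (e + 1 - u) + (ab.2 - 1) := by omega
          rw [h1, pow_add]
          ring

open Polynomial in
/-- Hasse derivatives of `r * h ^ e` as `h ^ (e - l)` times a linear function of `r`. -/
theorem exists_linearMap_hasseDeriv_mul_pow {K : Type*} [Field K] (h : K[X]) {m : ℕ}
    (hm : h.natDegree ≤ m) (e l : ℕ) (hle : l ≤ e) :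
    ∃ T : K[X] →ₗ[K] K[X], (∀ r, (T r).natDegree ≤ r.natDegree + l * m) ∧
      ∀ r, hasseDeriv l (r * h ^ e) = h ^ (e - l) * T r := by
  choose s hs hs' using exists_hasseDeriv_pow_eq h hm e
  refine ⟨∑ ab ∈ Finset.HasAntidiagonal.antidiagonal l,
    (LinearMap.mulLeft K (h ^ ab.1 * s ab.2)) ∘ₗ hasseDeriv ab.1, fun r => ?_, fun r => ?_⟩
  · simp only [LinearMap.sum_apply, LinearMap.comp_apply, LinearMap.mulLeft_apply]
    refine natDegree_sum_le_of_forall_le _ _ fun ab hab => ?_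
    rw [Finset.HasAntidiagonal.mem_antidiagonal] at hab
    refine natDegree_mul_le.trans ?_
    have h1 : (h ^ ab.1 * s ab.2).natDegree ≤ ab.1 * m + ab.2 * m := by
      refine natDegree_mul_le.trans (add_le_add ?_ (hs _))
      refine natDegree_pow_le.trans ?_
      gcongr
    have h2 : (hasseDeriv ab.1 r).natDegree ≤ r.natDegree :=
      (natDegree_hasseDeriv_le _ _).trans (Nat.sub_le _ _)
    have h3 : l * m = ab.1 * m + ab.2 * m := by rw [← hab]; ring
    omega
  · simp only [LinearMap.sum_apply, LinearMap.comp_apply, LinearMap.mulLeft_apply]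
    rw [hasseDeriv_mul, Finset.mul_sum]
    refine Finset.sum_congr rfl fun ab hab => ?_
    rw [Finset.HasAntidiagonal.mem_antidiagonal] at hab
    have h1 : e - ab.2 = (e - l) + ab.1 := by omega
    rw [hs', h1, pow_add]
    ring

open Polynomial in
/-- Sums of polynomials whose orders of vanishing at `0` are pairwise distinct are nonzero. -/
theorem sum_ne_zero_of_injOn_natTrailingDegree {K ι : Type*} [Field K] (S : Finset ι)
    (hS : S.Nonempty) (f : ι → K[X]) (hf : ∀ i ∈ S, f i ≠ 0)
    (hinj : Set.InjOn (fun i => (f i).natTrailingDegree) S) : ∑ i ∈ S, f i ≠ 0 := by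
  obtain ⟨i, hi, hmin⟩ := S.exists_min_image (fun i => (f i).natTrailingDegree) hS
  intro h0
  have h1 : (∑ j ∈ S, f j).coeff (f i).natTrailingDegree = (f i).trailingCoeff := by
    rw [finsetSum_coeff, Finset.sum_eq_single i]
    · rfl
    · intro j hj hji
      refine coeff_eq_zero_of_lt_natTrailingDegree (lt_of_le_of_ne (hmin j hj) fun h => hji ?_)
      exact (hinj hi hj h).symm
    · exact fun h => absurd hi h
  rw [h0, coeff_zero, eq_comm, trailingCoeff_eq_zero] at h1
  exact hf i hi h1

open Polynomial in
/-- The Stepanov auxiliary polynomial does not vanish. -/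
theorem stepanov_sum_ne_zero {K : Type*} [Field K] {D J e Q M : ℕ}
    (hQ : D * e < Q) (h u : K[X]) (hu : h = X * u) (hu0 : u.coeff 0 ≠ 0)
    (r : Fin D × Fin J → K[X]) (hr : ∀ q, (r q).degree < e) (hr0 : r ≠ 0) :
    ∑ q, r q * h ^ (M + q.1 * e) * X ^ (q.2 * Q : ℕ) ≠ 0 := by
  classical
  have hune : u ≠ 0 := by
    rintro rfl
    simp at hu0
  have hhne : h ≠ 0 := by
    rw [hu]
    exact mul_ne_zero X_ne_zero hune
  have hh1 : h.natTrailingDegree = 1 := by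
    rw [hu, natTrailingDegree_mul X_ne_zero hune, natTrailingDegree_X,
      natTrailingDegree_eq_zero.2 (Or.inr hu0)]
  have hsum : ∑ q, r q * h ^ (M + q.1 * e) * X ^ (q.2 * Q : ℕ) =
      ∑ q with r q ≠ 0, r q * h ^ (M + q.1 * e) * X ^ (q.2 * Q : ℕ) := by
    rw [Finset.sum_filter]
    refine Finset.sum_congr rfl fun q _ => ?_
    split_ifs with hq
    · rfl
    · rw [not_not.1 hq]
      simp
  have hpow : ∀ f : K[X], f ≠ 0 → ∀ n, (f ^ n).natTrailingDegree = n * f.natTrailingDegree := by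
    intro f hf n
    induction n with
    | zero => simp
    | succ n ih =>
      rw [pow_succ, natTrailingDegree_mul (pow_ne_zero _ hf) hf, ih]
      ring
  rw [hsum]
  refine sum_ne_zero_of_injOn_natTrailingDegree _ ?_ _ ?_ ?_
  · obtain ⟨q, hq⟩ := Function.ne_iff.1 hr0
    exact ⟨q, by simpa using hq⟩
  · intro q hq
    rw [Finset.mem_filter] at hq
    exact mul_ne_zero (mul_ne_zero hq.2 (pow_ne_zero _ hhne)) (pow_ne_zero _ X_ne_zero)
  · have key : ∀ q, r q ≠ 0 → ∃ v < e,
        (r q * h ^ (M + q.1 * e) * X ^ (q.2 * Q : ℕ)).natTrailingDegree =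
          M + (v + q.1 * e + q.2 * Q) := by
      intro q hq
      refine ⟨(r q).natTrailingDegree, ?_, ?_⟩
      · refine lt_of_le_of_lt (natTrailingDegree_le_natDegree _) ?_
        exact (natDegree_lt_iff_degree_lt hq).2 (hr q)
      · rw [natTrailingDegree_mul (mul_ne_zero hq (pow_ne_zero _ hhne)) (pow_ne_zero _ X_ne_zero),
          natTrailingDegree_mul hq (pow_ne_zero _ hhne), hpow _ hhne,
          hpow _ X_ne_zero, hh1, natTrailingDegree_X]
        ring
    have hlt : ∀ (i : Fin D) (v : ℕ), v < e → v + i * e < Q := by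
      intro i v hv
      have h1 : ((i : ℕ) + 1) * e ≤ D * e := Nat.mul_le_mul_right _ i.2
      have h2 : ((i : ℕ) + 1) * e = i * e + e := by ring
      omega
    intro q hq q' hq' hqq
    simp only [Finset.coe_filter, Finset.mem_univ, true_and, Set.mem_ofPred_eq] at hq hq'
    obtain ⟨v, hv, hveq⟩ := key q hq
    obtain ⟨v', hv', hveq'⟩ := key q' hq'
    simp only [hveq, hveq'] at hqq
    have hA := hlt q.1 v hv
    have hA' := hlt q'.1 v' hv'
    have hB : v + q.1 * e + q.2 * Q = v' + q'.1 * e + q'.2 * Q := by omega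
    have hQ0 : 0 < Q := by omega
    have h2 : (q.2 : ℕ) = q'.2 := by
      have := congrArg (· / Q) hB
      simpa [Nat.add_mul_div_right _ _ hQ0, Nat.div_eq_of_lt hA, Nat.div_eq_of_lt hA'] using this
    have hC : v + q.1 * e = v' + q'.1 * e := by rw [h2] at hB; omega
    have h1 : (q.1 : ℕ) = q'.1 := by
      have he : 0 < e := by omega
      have := congrArg (· / e) hC
      simpa [Nat.add_mul_div_right _ _ he, Nat.div_eq_of_lt hv, Nat.div_eq_of_lt hv'] using this
    exact Prod.ext (Fin.ext h1) (Fin.ext h2)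

open Polynomial in
/-- Existence of coefficients for which all the relevant Hasse derivatives vanish at the points
where `h ^ e = ζ`. -/
theorem exists_stepanov_coefficients {K : Type*} [Field K] {D J e M m : ℕ}
    (T : Fin M → Fin D → K[X] →ₗ[K] K[X])
    (hT : ∀ l i r, (T l i r).natDegree ≤ r.natDegree + l * m)
    (hcount : M * (e + M * m + J) < D * J * e) (ζ : K) :
    ∃ r : Fin D × Fin J → K[X], r ≠ 0 ∧ (∀ q, (r q).degree < e) ∧
      ∀ l, ∑ q, C (ζ ^ (q.1 : ℕ)) * X ^ (q.2 : ℕ) * T l q.1 (r q) = 0 := by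
  classical
  let R : Fin M → (Fin D × Fin J → degreeLT K e) →ₗ[K] K[X] := fun l =>
    ∑ q : Fin D × Fin J, LinearMap.mulLeft K (C (ζ ^ (q.1 : ℕ)) * X ^ (q.2 : ℕ)) ∘ₗ T l q.1 ∘ₗ
      (degreeLT K e).subtype ∘ₗ LinearMap.proj q
  have hRapp : ∀ l r, R l r =
      ∑ q, C (ζ ^ (q.1 : ℕ)) * X ^ (q.2 : ℕ) * T l q.1 (r q : K[X]) := by
    intro l r
    simp [R, LinearMap.sum_apply, mul_assoc]
  let L : (Fin D × Fin J → degreeLT K e) →ₗ[K] (Fin M × Fin (e + M * m + J) → K) :=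
    LinearMap.pi fun ln => lcoeff K ln.2 ∘ₗ R ln.1
  have hfin : Module.finrank K (degreeLT K e) = e := by
    rw [(degreeLTEquiv K e).finrank_eq]
    simp
  have : FiniteDimensional K (degreeLT K e) :=
    (degreeLTEquiv K e).symm.finiteDimensional
  have hker : LinearMap.ker L ≠ ⊥ := by
    refine LinearMap.ker_ne_bot_of_finrank_lt ?_
    rw [Module.finrank_fintype_fun_eq_card, Module.finrank_pi_fintype]
    simpa [hfin] using hcount
  obtain ⟨r, hrL, hr0⟩ := (Submodule.ne_bot_iff _).1 hker
  refine ⟨fun q => r q, ?_, fun q => mem_degreeLT.1 (r q).2, fun l => ?_⟩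
  · intro h0
    exact hr0 (funext fun q => Subtype.ext (congrFun h0 q))
  · rw [← hRapp]
    ext n
    rw [coeff_zero]
    rcases Nat.lt_or_ge n (e + M * m + J) with hn | hn
    · exact congrFun (LinearMap.mem_ker.1 hrL) (l, ⟨n, hn⟩)
    · have he : 0 < e := by
        rcases Nat.eq_zero_or_pos e with rfl | he
        · simp at hcount
        · exact he
      refine coeff_eq_zero_of_natDegree_lt (lt_of_lt_of_le ?_ hn)
      rw [hRapp]
      have hbound : ∀ q ∈ (Finset.univ : Finset (Fin D × Fin J)),
          (C (ζ ^ (q.1 : ℕ)) * X ^ (q.2 : ℕ) * T l q.1 (r q : K[X])).natDegree ≤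
            e + M * m + J - 1 := by
        intro q _
        have h1 : (T l q.1 (r q : K[X])).natDegree ≤ (e - 1) + M * m := by
          refine (hT _ _ _).trans (add_le_add ?_ (Nat.mul_le_mul_right _ l.2.le))
          by_cases hq : (r q : K[X]) = 0
          · simp [hq]
          · exact Nat.le_sub_one_of_lt
              ((natDegree_lt_iff_degree_lt hq).2 (mem_degreeLT.1 (r q).2))
        have h2 : (C (ζ ^ (q.1 : ℕ)) * X ^ (q.2 : ℕ)).natDegree ≤ (q.2 : ℕ) :=
          natDegree_C_mul_X_pow_le _ _
        have h3 := natDegree_mul_le (p := C (ζ ^ (q.1 : ℕ)) * X ^ (q.2 : ℕ))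
          (q := T l q.1 (r q : K[X]))
        have h4 := q.2.2
        omega
      have := natDegree_sum_le_of_forall_le _ _ hbound
      omega

open Polynomial in
theorem X_sub_C_pow_dvd_of_hasseDeriv_eval_eq_zero {K : Type*} [Field K] (f : K[X]) (a : K)
    (M : ℕ) (hf : ∀ l < M, (hasseDeriv l f).eval a = 0) : (X - C a) ^ M ∣ f := by
  have h1 : X ^ M ∣ taylor a f := by
    rw [X_pow_dvd_iff]
    intro l hl
    rw [taylor_coeff, hf l hl]
  obtain ⟨g, hg⟩ := h1
  refine ⟨taylor (-a) g, ?_⟩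
  have h2 : taylor (-a) (taylor a f) = f := by
    rw [taylor_taylor, neg_add_cancel, taylor_zero]
  rw [← h2, hg, taylor_mul, taylor_X_pow, C_neg, sub_eq_add_neg]

open Polynomial in
theorem X_sub_C_pow_card_dvd {K : Type*} [Field K] [Fintype K] (a : K) (j : ℕ) :
    (X - C a) ^ Fintype.card K ∣ X ^ (j * Fintype.card K) - C (a ^ j) := by
  have h1 : (X - C a) ^ Fintype.card K = X ^ Fintype.card K - C a := by
    rw [← FiniteField.expand_card]
    simp
  rw [h1, mul_comm, pow_mul, C_pow]
  exact sub_dvd_pow_sub_pow _ _ _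

open Polynomial in
/-- **Stepanov's bound**: the polynomial `h`, having a simple zero at `0`, takes values with
`h(x) ^ ((q - 1) / D) = ζ` about `q / D` times at most. -/
theorem stepanov_card_le {K : Type*} [Field K] [Fintype K] [DecidableEq K] {s D m : ℕ}
    (hs : 2 ≤ s) (hQ : Fintype.card K = s ^ 2) (hD : 0 < D) (hDs : D ∣ s - 1) (hm1 : 1 ≤ m)
    (h u : K[X]) (hdeg : h.natDegree ≤ m) (hu : h = X * u) (hu0 : u.coeff 0 ≠ 0) (ζ : K) :
    D * (Finset.univ.filter fun x : K => h.eval x ^ ((s ^ 2 - 1) / D) = ζ).card ≤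
      s ^ 2 + D * (5 * m + 2) * s := by
  classical
  obtain ⟨w, hw⟩ := hDs
  obtain ⟨M, rfl⟩ : ∃ M, s = M + 1 := ⟨s - 1, by omega⟩
  simp only [Nat.add_sub_cancel] at hw
  have hM : 1 ≤ M := by omega
  have hQ1 : (M + 1) ^ 2 - 1 = D * (w * (M + 2)) := by
    rw [← mul_assoc, ← hw, Nat.sub_eq_iff_eq_add (Nat.one_le_pow _ _ (by omega))]
    ring
  have he : ((M + 1) ^ 2 - 1) / D = w * (M + 2) := by
    rw [hQ1, Nat.mul_div_cancel_left _ hD]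
  rw [he]
  set e := w * (M + 2) with he_def
  set J := w + (m + 1) with hJ
  set Q := (M + 1) ^ 2 with hQdef
  have hDe : D * e + 1 = Q := by
    rw [← hQ1]
    exact Nat.sub_add_cancel (Nat.one_le_pow _ _ (by omega))
  set A := Finset.univ.filter fun x : K => h.eval x ^ e = ζ with hA
  have hT : ∀ (l : Fin M) (i : Fin D), ∃ T : K[X] →ₗ[K] K[X],
      (∀ r, (T r).natDegree ≤ r.natDegree + l * m) ∧
      ∀ r, hasseDeriv l (r * h ^ (M + i * e)) = h ^ (M + i * e - l) * T r := fun l i =>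
    exists_linearMap_hasseDeriv_mul_pow h hdeg _ _ (by have := l.2; omega)
  choose T hTdeg hT using hT
  have hcount : M * (e + M * m + J) < D * J * e := by
    have h1 : D * J * e = J * M * (M + 2) := by
      rw [he_def, hw]
      ring
    have h2 : J * M * (M + 2) = M * (J * (M + 1) + J) := by ring
    rw [h1, h2]
    refine Nat.mul_lt_mul_of_pos_left ?_ hM
    rw [he_def, hJ]
    nlinarith
  obtain ⟨r, hr0, hrdeg, hrT⟩ := exists_stepanov_coefficients T hTdeg hcount ζ
  set Φ := ∑ q : Fin D × Fin J, r q * h ^ (M + q.1 * e) * X ^ (q.2 * Q : ℕ) with hΦ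
  have hΦ0 : Φ ≠ 0 := stepanov_sum_ne_zero (by omega) h u hu hu0 r hrdeg hr0
  have hdvd : ∀ a ∈ A, (X - C a) ^ M ∣ Φ := by
    intro a ha
    have ha' : h.eval a ^ e = ζ := by simpa [hA] using ha
    have h1 : (X - C a) ^ M ∣ ∑ q : Fin D × Fin J, C (a ^ (q.2 : ℕ)) *
        (r q * h ^ (M + q.1 * e)) := by
      refine X_sub_C_pow_dvd_of_hasseDeriv_eval_eq_zero _ _ _ fun l hl => ?_
      have h2 := congrArg (eval a) (hrT ⟨l, hl⟩)
      rw [eval_finsetSum, eval_zero] at h2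
      rw [map_sum, eval_finsetSum, ← mul_zero (h.eval a ^ (M - l)), ← h2, Finset.mul_sum]
      refine Finset.sum_congr rfl fun q _ => ?_
      rw [← smul_eq_C_mul, map_smul, hT ⟨l, hl⟩ q.1, eval_smul, eval_mul, eval_mul, eval_mul,
        eval_C, eval_pow, eval_pow, eval_X, ← ha', smul_eq_mul]
      have h3 : M + (q.1 : ℕ) * e - l = (M - l) + e * q.1 := by
        rw [mul_comm e]
        omega
      simp only [h3, pow_add, pow_mul]
      ring
    have h4 : (X - C a) ^ M ∣ Φ - ∑ q : Fin D × Fin J, C (a ^ (q.2 : ℕ)) *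
        (r q * h ^ (M + q.1 * e)) := by
      rw [hΦ, ← Finset.sum_sub_distrib]
      refine Finset.dvd_sum fun q _ => ?_
      have h5 : (X - C a) ^ M ∣ X ^ ((q.2 : ℕ) * Q) - C (a ^ (q.2 : ℕ)) := by
        rw [← hQ]
        refine dvd_trans (pow_dvd_pow _ ?_) (X_sub_C_pow_card_dvd a q.2)
        rw [hQ, hQdef]
        nlinarith
      have h6 : r q * h ^ (M + q.1 * e) * X ^ (q.2 * Q : ℕ) -
          C (a ^ (q.2 : ℕ)) * (r q * h ^ (M + q.1 * e)) =
          r q * h ^ (M + q.1 * e) * (X ^ ((q.2 : ℕ) * Q) - C (a ^ (q.2 : ℕ))) := by ring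
      rw [h6]
      exact Dvd.dvd.mul_left h5 _
    exact (dvd_sub_left h1).1 h4
  have hprod : ∏ a ∈ A, (X - C a) ^ M ∣ Φ := by
    refine Finset.prod_dvd_of_coprime ?_ hdvd
    intro a _ b _ hab
    exact (pairwise_coprime_X_sub_C Function.injective_id hab).pow
  have hle : M * A.card ≤ Φ.natDegree := by
    have h1 := natDegree_le_of_dvd hprod hΦ0
    rw [natDegree_prod_of_monic _ _ fun a _ => (monic_X_sub_C a).pow _] at h1
    simpa [natDegree_pow, mul_comm] using h1
  have hΦdeg : Φ.natDegree ≤ e + m * (M + (D - 1) * e) + (J - 1) * Q := by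
    refine natDegree_sum_le_of_forall_le _ _ fun q _ => ?_
    have h1 : (r q).natDegree ≤ e := natDegree_le_of_degree_le (hrdeg q).le
    have h2 : (h ^ (M + q.1 * e)).natDegree ≤ m * (M + (D - 1) * e) := by
      refine natDegree_pow_le.trans ?_
      rw [mul_comm m]
      gcongr
      have := q.1.2
      omega
    have h3 : (X ^ (q.2 * Q : ℕ) : K[X]).natDegree ≤ (J - 1) * Q := by
      rw [natDegree_X_pow]
      gcongr
      have := q.2.2
      omega
    exact natDegree_mul_le.trans (add_le_add (natDegree_mul_le.trans (add_le_add h1 h2)) h3)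
  have hfin : M * (D * A.card) ≤ M * (Q + D * (5 * m + 2) * (M + 1)) := by
    have h1 : e + m * (M + (D - 1) * e) + (J - 1) * Q ≤ m * M + m * Q + J * Q := by
      have h2 : e + m * ((D - 1) * e) ≤ m * (D * e) := by
        obtain ⟨D', rfl⟩ : ∃ D', D = D' + 1 := ⟨D - 1, by omega⟩
        simp only [Nat.add_sub_cancel]
        nlinarith
      have h3 : m * (D * e) ≤ m * Q := Nat.mul_le_mul_left _ (by omega)
      have h4 : (J - 1) * Q ≤ J * Q := Nat.mul_le_mul_right _ (by omega)
      rw [mul_add]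
      omega
    have h5 : M * A.card ≤ m * M + m * Q + J * Q := (hle.trans hΦdeg).trans h1
    have h6 : D * (m * M + m * Q + J * Q) = D * m * M + D * m * Q + M * Q + D * (m + 1) * Q := by
      rw [hJ]
      have : D * ((w + (m + 1)) * Q) = (D * w) * Q + D * (m + 1) * Q := by ring
      rw [mul_add, mul_add, this, ← hw]
      ring
    have h7 : Q ≤ 2 * (M + 1) * M := by
      rw [hQdef]
      nlinarith
    calc M * (D * A.card) = D * (M * A.card) := by ring
      _ ≤ D * (m * M + m * Q + J * Q) := Nat.mul_le_mul_left _ h5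
      _ = D * m * M + M * Q + D * (2 * m + 1) * Q := by rw [h6]; ring
      _ ≤ D * m * (M * (M + 1)) + M * Q + D * (2 * m + 1) * (2 * (M + 1) * M) := by
        refine Nat.add_le_add (Nat.add_le_add (Nat.mul_le_mul_left _ ?_) le_rfl)
          (Nat.mul_le_mul_left _ h7)
        exact Nat.le_mul_of_pos_right _ (Nat.succ_pos _)
      _ = M * (Q + D * (5 * m + 2) * (M + 1)) := by ring
  exact Nat.le_of_mul_le_mul_left hfin hM

open Polynomial IntermediateField in
/-- The characteristic polynomial of an element of a finite extension, as a power of its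
minimal polynomial. -/
noncomputable def conjPoly (F : Type*) {L : Type*} [Field F] [Field L] [Algebra F L] (x : L) :
    F[X] :=
  minpoly F x ^ Module.finrank F⟮x⟯ L

section conjPoly

open Polynomial IntermediateField

variable {F L : Type*} [Field F] [Field L] [Algebra F L] [FiniteDimensional F L]

theorem conjPoly_monic (x : L) : (conjPoly F x).Monic :=
  (minpoly.monic (Algebra.IsIntegral.isIntegral x)).pow _

theorem natDegree_minpoly_mul_finrank (x : L) :
    (minpoly F x).natDegree * Module.finrank F⟮x⟯ L = Module.finrank F L := by
  rw [← adjoin.finrank (Algebra.IsIntegral.isIntegral x), Module.finrank_mul_finrank]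

theorem natDegree_conjPoly (x : L) : (conjPoly F x).natDegree = Module.finrank F L := by
  rw [conjPoly, natDegree_pow, mul_comm, natDegree_minpoly_mul_finrank]

theorem eval_conjPoly (x : L) (t : F) :
    (conjPoly F x).eval t = Algebra.norm F (algebraMap F L t - x) := by
  have hx : IsIntegral F x := Algebra.IsIntegral.isIntegral x
  have h1 : algebraMap F L t - x =
      algebraMap F⟮x⟯ L (algebraMap F F⟮x⟯ t - AdjoinSimple.gen F x) := by
    simp
  have h2 : Algebra.norm F (algebraMap F F⟮x⟯ t - AdjoinSimple.gen F x) =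
      (minpoly F x).eval t := by
    have h3 := charpoly_leftMulMatrix (adjoin.powerBasis hx)
    rw [adjoin.powerBasis_gen, minpoly_gen] at h3
    rw [← h3, Matrix.eval_charpoly, Algebra.norm_eq_matrix_det (adjoin.powerBasis hx).basis,
      map_sub]
    congr 2
    rw [AlgHom.commutes]
    rfl
  rw [h1, ← Algebra.norm_norm (S := F⟮x⟯), Algebra.norm_algebraMap, map_pow, h2, conjPoly,
    eval_pow]

theorem nextCoeff_conjPoly (x : L) :
    (conjPoly F x).nextCoeff = -Algebra.trace F L x := by
  rw [trace_eq_finrank_mul_minpoly_nextCoeff, conjPoly,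
    Monic.nextCoeff_pow (minpoly.monic (Algebra.IsIntegral.isIntegral x))]
  simp

end conjPoly

open Polynomial IntermediateField in
theorem card_filter_minpoly_eq {F L : Type*} [Field F] [Finite F] [Field L] [Algebra F L]
    [Fintype L] [DecidableEq F] (P : F[X]) (hP : Irreducible P) (hPm : P.Monic) :
    (Finset.univ.filter fun x : L => minpoly F x = P).card =
      if P.natDegree ∣ Module.finrank F L then P.natDegree else 0 := by
  classical
  have hfd : FiniteDimensional F L := .of_finite
  split_ifs with hd
  · have : Fact (Irreducible P) := ⟨hP⟩
    have : Finite (AdjoinRoot P) := by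
      have : FiniteDimensional F (AdjoinRoot P) := (AdjoinRoot.powerBasis hP.ne_zero).finite
      exact Module.finite_of_finite F
    obtain ⟨φ⟩ : Nonempty (AdjoinRoot P →ₐ[F] L) := by
      refine FiniteField.nonempty_algHom_of_finrank_dvd ?_
      rwa [(AdjoinRoot.powerBasis hP.ne_zero).finrank, AdjoinRoot.powerBasis_dim]
    have hroot : aeval (φ (AdjoinRoot.root P)) P = 0 := by
      rw [aeval_algHom_apply, AdjoinRoot.aeval_eq, AdjoinRoot.mk_self, map_zero]
    have hsplit : Splits (P.map (algebraMap F L)) := by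
      rw [minpoly.eq_of_irreducible_of_monic hP hroot hPm]
      exact Normal.splits inferInstance _
    rw [← card_rootSet_eq_natDegree (PerfectField.separable_of_irreducible hP) hsplit,
      ← Set.toFinset_card]
    congr 1
    ext x
    rw [Finset.mem_filter, Set.mem_toFinset, mem_rootSet_of_ne hP.ne_zero]
    refine ⟨fun h => h.2 ▸ minpoly.aeval F x, fun h => ⟨Finset.mem_univ _, ?_⟩⟩
    exact (minpoly.eq_of_irreducible_of_monic hP h hPm).symm
  · rw [Finset.card_eq_zero, Finset.filter_eq_empty_iff]
    rintro x - rfl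
    exact hd ⟨_, (natDegree_minpoly_mul_finrank x).symm⟩

open Polynomial UniqueFactorizationMonoid in
theorem sum_count_normalizedFactors_mul_natDegree {F : Type*} [Field F] [DecidableEq F]
    {g : F[X]} (hg : g ≠ 0) :
    ∑ P ∈ (normalizedFactors g).toFinset, (normalizedFactors g).count P * P.natDegree =
      g.natDegree := by
  have h1 := Finset.sum_multiset_map_count (normalizedFactors g) natDegree
  simp only [smul_eq_mul] at h1
  rw [← h1, ← natDegree_multiset_prod _ (zero_notMem_normalizedFactors g)]
  exact natDegree_eq_of_degree_eq (degree_eq_degree_of_associated (prod_normalizedFactors hg))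

noncomputable instance fintypeGaloisField (p n : ℕ) [Fact p.Prime] :
    Fintype (GaloisField p n) := Fintype.ofFinite _

open Polynomial IntermediateField UniqueFactorizationMonoid in
open scoped Classical in
theorem card_filter_conjPoly_dvd {F L : Type*} [Field F] [Finite F] [Field L] [Algebra F L]
    [Fintype L] {g : F[X]} (hg : g ≠ 0) :
    (Finset.univ.filter fun x : L => conjPoly F x ∣ g).card =
      ∑ P ∈ (normalizedFactors g).toFinset,
        if P.natDegree ∣ Module.finrank F L ∧ Module.finrank F L / P.natDegree ≤
          (normalizedFactors g).count P then P.natDegree else 0 := by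
  have hfd : FiniteDimensional F L := .of_finite
  rw [Finset.card_eq_sum_card_fiberwise (f := fun x => minpoly F x)
    (t := (normalizedFactors g).toFinset)]
  · refine Finset.sum_congr rfl fun P hP => ?_
    rw [Multiset.mem_toFinset, Polynomial.mem_normalizedFactors_iff hg] at hP
    obtain ⟨hPi, hPm, hPg⟩ := hP
    have hP0 : 0 < P.natDegree := hPi.natDegree_pos
    have hpow : ∀ j, P ^ j ∣ g ↔ j ≤ (normalizedFactors g).count P := by
      intro j
      rw [pow_dvd_iff_le_emultiplicity, emultiplicity_eq_count_normalizedFactors hPi hg,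
        hPm.normalize_eq_self, Nat.cast_le]
    have hfr : ∀ x : L, minpoly F x = P →
        conjPoly F x = P ^ (Module.finrank F L / P.natDegree) := by
      rintro x rfl
      rw [conjPoly, ← Nat.mul_div_cancel_left (Module.finrank F⟮x⟯ L) hP0,
        natDegree_minpoly_mul_finrank]
    by_cases hc : Module.finrank F L / P.natDegree ≤ (normalizedFactors g).count P
    · simp only [hc, and_true]
      rw [← card_filter_minpoly_eq P hPi hPm, Finset.filter_filter]
      congr 1
      refine Finset.filter_congr fun x _ => ⟨fun h => h.2, fun h => ⟨?_, h⟩⟩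
      rw [hfr x h]
      exact (hpow _).2 hc
    · simp only [hc, and_false, if_false]
      rw [Finset.card_eq_zero, Finset.filter_filter, Finset.filter_eq_empty_iff]
      rintro x - ⟨h1, h2⟩
      rw [hfr x h2] at h1
      exact hc ((hpow _).1 h1)
  · intro x hx
    have hx' : conjPoly F x ∣ g := by simpa using hx
    have hi : IsIntegral F x := Algebra.IsIntegral.isIntegral x
    simp only [Finset.mem_coe, Multiset.mem_toFinset]
    rw [Polynomial.mem_normalizedFactors_iff hg]
    exact ⟨minpoly.irreducible hi, minpoly.monic hi,
      (dvd_pow_self _ Module.finrank_pos.ne').trans hx'⟩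

open Polynomial UniqueFactorizationMonoid in
open scoped Classical in
/-- Counting the elements of the fields `𝔽_{p^k}`, `1 ≤ k ≤ n`, whose characteristic polynomial
divides a given polynomial of degree `n`. -/
theorem sum_card_filter_conjPoly_dvd {p : ℕ} [Fact p.Prime] {g : (ZMod p)[X]} (hg : g ≠ 0) :
    ∑ k ∈ Finset.Icc 1 g.natDegree,
      (Finset.univ.filter fun x : GaloisField p k => conjPoly (ZMod p) x ∣ g).card =
      g.natDegree := by
  conv_rhs => rw [← sum_count_normalizedFactors_mul_natDegree hg]
  have h1 : ∀ k ∈ Finset.Icc 1 g.natDegree,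
      (Finset.univ.filter fun x : GaloisField p k => conjPoly (ZMod p) x ∣ g).card =
      ∑ P ∈ (normalizedFactors g).toFinset,
        if P.natDegree ∣ k ∧ k / P.natDegree ≤ (normalizedFactors g).count P
          then P.natDegree else 0 := by
    intro k hk
    rw [Finset.mem_Icc] at hk
    rw [card_filter_conjPoly_dvd hg, GaloisField.finrank p (by omega)]
    congr!
  rw [Finset.sum_congr rfl h1, Finset.sum_comm]
  refine Finset.sum_congr rfl fun P hP => ?_
  have hPle : (normalizedFactors g).count P * P.natDegree ≤ g.natDegree := by
    rw [← sum_count_normalizedFactors_mul_natDegree hg]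
    exact Finset.single_le_sum
      (f := fun P => (normalizedFactors g).count P * P.natDegree) (fun _ _ => Nat.zero_le _) hP
  rw [Multiset.mem_toFinset, Polynomial.mem_normalizedFactors_iff hg] at hP
  have hP0 : 0 < P.natDegree := hP.1.natDegree_pos
  rw [← Finset.sum_filter, Finset.sum_const, smul_eq_mul]
  congr 1
  generalize (normalizedFactors g).count P = v at hPle ⊢
  have hcard : (Finset.Icc 1 v).card = v := by simp
  refine Eq.trans (Eq.symm ?_) hcard
  refine Finset.card_bij (fun j _ => P.natDegree * j) ?_ ?_ ?_
  · intro j hj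
    rw [Finset.mem_Icc] at hj
    rw [Finset.mem_filter, Finset.mem_Icc]
    refine ⟨⟨Nat.mul_pos hP0 hj.1, ?_⟩, dvd_mul_right _ _, ?_⟩
    · refine le_trans ?_ hPle
      rw [mul_comm]
      exact Nat.mul_le_mul_right _ hj.2
    · rw [Nat.mul_div_cancel_left _ hP0]
      exact hj.2
  · intro j _ j' _ h
    exact Nat.eq_of_mul_eq_mul_left hP0 h
  · intro k hk
    rw [Finset.mem_filter, Finset.mem_Icc] at hk
    obtain ⟨⟨hk1, -⟩, ⟨j, rfl⟩, hj⟩ := hk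
    rw [Nat.mul_div_cancel_left _ hP0] at hj
    exact ⟨j, Finset.mem_Icc.2 ⟨Nat.pos_of_mul_pos_left hk1, hj⟩, rfl⟩

open Polynomial in
theorem finite_setOf_monic_natDegree_eq (F : Type*) [Field F] [Finite F] (n : ℕ) :
    {g : F[X] | g.Monic ∧ g.natDegree = n}.Finite := by
  have h1 : Finite (degreeLT F (n + 1)) :=
    Finite.of_injective _ (degreeLTEquiv F (n + 1)).injective
  refine (Set.toFinite ((degreeLT F (n + 1) : Submodule F F[X]) : Set F[X])).subset ?_
  rintro g ⟨hg, rfl⟩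
  rw [SetLike.mem_coe, mem_degreeLT]
  exact degree_le_natDegree.trans_lt (by exact_mod_cast Nat.lt_succ_self _)

open Polynomial in
/-- The finite set of monic polynomials of degree `n` over a finite field. -/
noncomputable def monicsOfDegree (F : Type*) [Field F] [Finite F] (n : ℕ) : Finset F[X] :=
  (finite_setOf_monic_natDegree_eq F n).toFinset

section monicsOfDegree

open Polynomial

theorem mem_monicsOfDegree {F : Type*} [Field F] [Finite F] {n : ℕ} {g : F[X]} :
    g ∈ monicsOfDegree F n ↔ g.Monic ∧ g.natDegree = n := by
  simp [monicsOfDegree]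

theorem monicsOfDegree_zero (F : Type*) [Field F] [Finite F] : monicsOfDegree F 0 = {1} := by
  ext g
  rw [mem_monicsOfDegree, Finset.mem_singleton]
  refine ⟨fun h => h.1.natDegree_eq_zero.1 h.2, ?_⟩
  rintro rfl
  simp

theorem sum_monicsOfDegree_one {F : Type*} [Field F] [Fintype F] (f : F[X] → ℂ) :
    ∑ g ∈ monicsOfDegree F 1, f g = ∑ c : F, f (X - C c) := by
  symm
  refine Finset.sum_bij (fun c _ => X - C c) ?_ ?_ ?_ ?_
  · intro c _
    rw [mem_monicsOfDegree]
    exact ⟨monic_X_sub_C c, natDegree_X_sub_C c⟩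
  · intro c _ c' _ h
    simpa using h
  · intro g hg
    rw [mem_monicsOfDegree] at hg
    refine ⟨-g.coeff 0, Finset.mem_univ _, ?_⟩
    rw [hg.1.eq_X_add_C hg.2]
    simp
  · intro c _
    rfl

open scoped Classical in
theorem sum_filter_dvd_monicsOfDegree {F : Type*} [Field F] [Finite F] {f : F[X] → ℂ}
    (hmul : ∀ g h : F[X], g.Monic → h.Monic → f (g * h) = f g * f h) {q : F[X]} (hq : q.Monic)
    {n : ℕ} (hqn : q.natDegree ≤ n) :
    ∑ g ∈ (monicsOfDegree F n).filter (fun g => q ∣ g), f g =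
      f q * ∑ g ∈ monicsOfDegree F (n - q.natDegree), f g := by
  rw [Finset.mul_sum]
  symm
  refine Finset.sum_bij (fun g _ => q * g) ?_ ?_ ?_ ?_
  · intro g hg
    rw [mem_monicsOfDegree] at hg
    rw [Finset.mem_filter, mem_monicsOfDegree, hq.natDegree_mul hg.1]
    exact ⟨⟨hq.mul hg.1, by omega⟩, dvd_mul_right _ _⟩
  · intro g _ g' _ h
    exact mul_left_cancel₀ hq.ne_zero h
  · intro g hg
    rw [Finset.mem_filter, mem_monicsOfDegree] at hg
    obtain ⟨⟨h1, h2⟩, ⟨k, rfl⟩⟩ := hg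
    have hk : k.Monic := hq.of_mul_monic_left h1
    refine ⟨k, ?_, rfl⟩
    rw [mem_monicsOfDegree]
    rw [hq.natDegree_mul hk] at h2
    exact ⟨hk, by omega⟩
  · intro g hg
    rw [mem_monicsOfDegree] at hg
    exact (hmul _ _ hq hg.1).symm

/-- The recursion between the coefficients of the `L`-function of a completely multiplicative
weight on monic polynomials and its power sums, which comes from the Euler product. -/
theorem natCast_mul_sum_monicsOfDegree {p : ℕ} [Fact p.Prime] {f : (ZMod p)[X] → ℂ}
    (hmul : ∀ g h : (ZMod p)[X], g.Monic → h.Monic → f (g * h) = f g * f h) (n : ℕ) :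
    (n : ℂ) * ∑ g ∈ monicsOfDegree (ZMod p) n, f g =
      ∑ k ∈ Finset.Icc 1 n, (∑ x : GaloisField p k, f (conjPoly (ZMod p) x)) *
        ∑ g ∈ monicsOfDegree (ZMod p) (n - k), f g := by
  classical
  have h1 : ∀ g ∈ monicsOfDegree (ZMod p) n, (n : ℂ) * f g =
      ∑ k ∈ Finset.Icc 1 n, ∑ x : GaloisField p k,
        if conjPoly (ZMod p) x ∣ g then f g else 0 := by
    intro g hg
    rw [mem_monicsOfDegree] at hg
    have h2 := sum_card_filter_conjPoly_dvd hg.1.ne_zero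
    rw [hg.2] at h2
    conv_lhs => rw [← h2]
    rw [Nat.cast_sum, Finset.sum_mul]
    refine Finset.sum_congr rfl fun k _ => ?_
    rw [← Finset.sum_filter, Finset.sum_const, nsmul_eq_mul]
  rw [Finset.mul_sum, Finset.sum_congr rfl h1, Finset.sum_comm]
  refine Finset.sum_congr rfl fun k hk => ?_
  rw [Finset.mem_Icc] at hk
  rw [Finset.sum_comm, Finset.sum_mul]
  refine Finset.sum_congr rfl fun x _ => ?_
  have hfd : FiniteDimensional (ZMod p) (GaloisField p k) := .of_finite
  have hd : (conjPoly (ZMod p) x).natDegree = k := by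
    rw [natDegree_conjPoly, GaloisField.finrank p (by omega)]
  rw [← Finset.sum_filter, sum_filter_dvd_monicsOfDegree hmul (conjPoly_monic x) (by omega), hd]

end monicsOfDegree

section charWeight

open Polynomial

variable {p : ℕ} [Fact p.Prime] (χ : MulChar (ZMod p) ℂ) (ψ : AddChar (ZMod p) ℂ)
  (T : Finset (ZMod p))

/-- The completely multiplicative weight on monic polynomials attached to a mixed character
sum. -/
noncomputable def charWeight (g : (ZMod p)[X]) : ℂ :=
  χ (∏ t ∈ T, g.eval t) * ψ (-g.nextCoeff)

theorem charWeight_mul (g h : (ZMod p)[X]) (hg : g.Monic) (hh : h.Monic) :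
    charWeight χ ψ T (g * h) = charWeight χ ψ T g * charWeight χ ψ T h := by
  simp only [charWeight, eval_mul, Finset.prod_mul_distrib, map_mul, hg.nextCoeff_mul hh, neg_add,
    AddChar.map_add_eq_mul]
  ring

theorem charWeight_one : charWeight χ ψ T 1 = 1 := by
  have h : (1 : (ZMod p)[X]).nextCoeff = 0 := by simp [nextCoeff]
  simp [charWeight, h]

theorem charWeight_X_sub_C (c : ZMod p) :
    charWeight χ ψ T (X - C c) = χ (∏ t ∈ T, (t - c)) * ψ c := by
  simp [charWeight]

theorem charWeight_conjPoly {L : Type*} [Field L] [Algebra (ZMod p) L]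
    [FiniteDimensional (ZMod p) L] (x : L) :
    charWeight χ ψ T (conjPoly (ZMod p) x) =
      χ (Algebra.norm (ZMod p) (∏ t ∈ T, (algebraMap (ZMod p) L t - x))) *
        ψ (Algebra.trace (ZMod p) L x) := by
  simp only [charWeight, eval_conjPoly, nextCoeff_conjPoly, neg_neg, map_prod]

/-- The coefficients of the `L`-function of a mixed character sum. -/
noncomputable def lCoeff (n : ℕ) : ℂ := ∑ g ∈ monicsOfDegree (ZMod p) n, charWeight χ ψ T g

theorem lCoeff_zero : lCoeff χ ψ T 0 = 1 := by
  rw [lCoeff, monicsOfDegree_zero, Finset.sum_singleton, charWeight_one]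

theorem lCoeff_one : lCoeff χ ψ T 1 = ∑ c, χ (∏ t ∈ T, (t - c)) * ψ c := by
  simp only [lCoeff, sum_monicsOfDegree_one, charWeight_X_sub_C]

variable {χ T}

theorem lCoeff_eq_zero (hχ : χ ≠ 1) (hT : T.Nonempty) {n : ℕ} (hn : T.card < n) :
    lCoeff χ ψ T n = 0 := by
  obtain ⟨t₁, ht₁⟩ := hT
  obtain ⟨u, hu⟩ := MulChar.ne_one_iff.1 hχ
  set w : (ZMod p)[X] := Lagrange.basis T id t₁ with hw
  have hw1 : w.eval t₁ = 1 := Lagrange.eval_basis_self Function.injective_id.injOn ht₁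
  have hw0 : ∀ t ∈ T, t ≠ t₁ → w.eval t = 0 := fun t ht h =>
    Lagrange.eval_basis_of_ne (v := id) h.symm ht
  have hTc : 1 ≤ T.card := Finset.card_pos.2 ⟨t₁, ht₁⟩
  have hwd : w.natDegree < n - 1 := by
    have := Lagrange.degree_basis (v := id) Function.injective_id.injOn ht₁
    rw [← hw] at this
    rw [natDegree_eq_of_degree_eq_some this]
    omega
  have hcoeff : ∀ (g : (ZMod p)[X]) (a : ZMod p) (i : ℕ), n - 1 ≤ i →
      (g + C a * w).coeff i = g.coeff i := by
    intro g a i hi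
    rw [coeff_add, coeff_C_mul, coeff_eq_zero_of_natDegree_lt (hwd.trans_le hi), mul_zero,
      add_zero]
  have hmem : ∀ (g : (ZMod p)[X]) (a : ZMod p), g ∈ monicsOfDegree (ZMod p) n →
      g + C a * w ∈ monicsOfDegree (ZMod p) n := by
    intro g a hg
    rw [mem_monicsOfDegree] at hg ⊢
    have hd : (C a * w).natDegree < g.natDegree :=
      (natDegree_C_mul_le _ _).trans_lt (by omega)
    exact ⟨hg.1.add_of_left (degree_lt_degree hd),
      by rw [natDegree_add_eq_left_of_natDegree_lt hd, hg.2]⟩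
  set φ : ZMod p → (ZMod p)[X] → (ZMod p)[X] :=
    fun v g => g + C ((v - 1) * g.eval t₁) * w with hφ
  have hev : ∀ v g, (φ v g).eval t₁ = v * g.eval t₁ := by
    intro v g
    simp only [hφ, eval_add, eval_mul, eval_C, hw1]
    ring
  have hinv : ∀ v v' g, v * v' = 1 → φ v (φ v' g) = g := by
    intro v v' g hv
    have h1 : φ v (φ v' g) = φ v' g + C ((v - 1) * (φ v' g).eval t₁) * w := rfl
    rw [h1, hev]
    simp only [hφ]
    rw [add_assoc, ← add_mul, ← C_add]
    have h2 : (v' - 1) * g.eval t₁ + (v - 1) * (v' * g.eval t₁) = (v * v' - 1) * g.eval t₁ := by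
      ring
    rw [h2, hv]
    simp
  have hweight : ∀ g ∈ monicsOfDegree (ZMod p) n,
      charWeight χ ψ T (φ u g) = χ u * charWeight χ ψ T g := by
    intro g hg
    have hg' := hmem g (((u : ZMod p) - 1) * g.eval t₁) hg
    rw [mem_monicsOfDegree] at hg hg'
    have h1 : (φ u g).nextCoeff = g.nextCoeff := by
      rw [nextCoeff_of_natDegree_pos, nextCoeff_of_natDegree_pos]
      · simp only [hφ]
        rw [hg'.2, hg.2, hcoeff _ _ _ le_rfl]
      · omega
      · simp only [hφ]
        omega
    have h2 : ∏ t ∈ T, (φ u g).eval t = u * ∏ t ∈ T, g.eval t := by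
      rw [← Finset.mul_prod_erase _ _ ht₁, ← Finset.mul_prod_erase T (fun t => g.eval t) ht₁, hev,
        mul_assoc]
      congr 2
      refine Finset.prod_congr rfl fun t ht => ?_
      rw [Finset.mem_erase] at ht
      simp [hφ, hw0 t ht.2 ht.1]
    rw [charWeight, h1, h2, map_mul, charWeight, mul_assoc]
  have hsum : lCoeff χ ψ T n = χ u * lCoeff χ ψ T n := by
    conv_rhs => rw [lCoeff, Finset.mul_sum]
    rw [lCoeff]
    symm
    refine Finset.sum_bij' (fun g _ => φ u g) (fun g _ => φ (↑u⁻¹ : ZMod p) g) ?_ ?_ ?_ ?_ ?_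
    · exact fun g hg => hmem _ _ hg
    · exact fun g hg => hmem _ _ hg
    · exact fun g _ => hinv _ _ g (Units.inv_mul u)
    · exact fun g _ => hinv _ _ g (Units.mul_inv u)
    · exact fun g hg => (hweight g hg).symm
  have h3 : (1 - χ u) * lCoeff χ ψ T n = 0 := by
    rw [sub_mul, one_mul, sub_eq_zero]
    exact hsum
  exact (mul_eq_zero.1 h3).resolve_left (sub_ne_zero.2 (Ne.symm hu))

end charWeight

open Polynomial in
/-- Newton's identities: a sequence satisfying the recursion of power sums is, up to sign, the
sequence of power sums of finitely many complex numbers. -/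
theorem exists_power_sums_of_recursion {d : ℕ} {a s : ℕ → ℂ} (ha0 : a 0 = 1)
    (had : ∀ n, d < n → a n = 0)
    (hrec : ∀ n : ℕ, (n : ℂ) * a n = ∑ k ∈ Finset.Icc 1 n, s k * a (n - k)) :
    ∃ μ : Fin d → ℂ, ∀ k, 1 ≤ k → s k = -∑ i, μ i ^ k := by
  set f : ℂ[X] := ∑ j ∈ Finset.range (d + 1), C (a j) * X ^ (d - j) with hf
  have hcoeff : ∀ j, j ≤ d → f.coeff (d - j) = a j := by
    intro j hj
    rw [hf, finsetSum_coeff, Finset.sum_eq_single j]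
    · simp
    · intro i hi hij
      rw [Finset.mem_range] at hi
      rw [coeff_C_mul_X_pow, if_neg (by omega)]
    · intro h
      exact absurd (Finset.mem_range.2 (by omega)) h
  have hle : f.natDegree ≤ d := natDegree_sum_le_of_forall_le _ _ fun j _ =>
    (natDegree_C_mul_X_pow_le _ _).trans (Nat.sub_le _ _)
  have hmon : f.Monic := monic_of_natDegree_le_of_coeff_eq_one d hle (by
    simpa [ha0] using hcoeff 0 (Nat.zero_le _))
  have hdeg : f.natDegree = d := le_antisymm hle (le_natDegree_of_ne_zero (by
    have := hcoeff 0 (Nat.zero_le _)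
    rw [Nat.sub_zero, ha0] at this
    rw [this]
    exact one_ne_zero))
  have hsp : Splits f := IsAlgClosed.splits f
  have hcard : Multiset.card f.roots = d := by
    rw [← hdeg, hsp.natDegree_eq_card_roots]
  have hcard' : Fintype.card f.roots = d := by
    rw [Multiset.card_coe, hcard]
  set e := Fintype.equivFinOfCardEq hcard'
  set μ : Fin d → ℂ := fun i => ((e.symm i : f.roots) : ℂ) with hμ
  have hroots : (Finset.univ : Finset (Fin d)).val.map μ = f.roots := by
    have h1 : (Finset.univ : Finset (Fin d)) = Finset.univ.map e.toEmbedding := by simp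
    rw [h1, Finset.map_val, Multiset.map_map]
    refine Eq.trans ?_ (Multiset.map_univ_coe f.roots)
    refine Multiset.map_congr rfl fun x _ => ?_
    simp [hμ]
  have hesymm : ∀ j, f.roots.esymm j = (-1) ^ j * a j := by
    intro j
    rcases le_or_gt j d with hj | hj
    · have h1 := Multiset.prod_X_sub_C_coeff f.roots (k := d - j) (by omega)
      rw [← hsp.eq_prod_roots_of_monic hmon, hcoeff j hj, hcard, Nat.sub_sub_self hj] at h1
      rw [h1, ← mul_assoc, ← mul_pow]
      simp
    · rw [had j hj, mul_zero, Multiset.esymm, Multiset.powersetCard_eq_empty _ (by omega)]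
      simp
  have hnewton : ∀ n : ℕ, (n : ℂ) * a n =
      ∑ k ∈ Finset.Icc 1 n, (-∑ i, μ i ^ k) * a (n - k) := by
    intro n
    have h1 := congrArg (MvPolynomial.aeval μ) (MvPolynomial.mul_esymm_eq_sum (Fin d) ℂ n)
    simp only [map_mul, map_natCast, map_pow, map_neg, map_one, map_sum,
      MvPolynomial.aeval_esymm_eq_multiset_esymm, hroots, hesymm, MvPolynomial.psum,
      MvPolynomial.aeval_X] at h1
    have h2 : (n : ℂ) * a n = (-1) ^ n * (n * ((-1) ^ n * a n)) := by
      have : ((-1 : ℂ) ^ n) * (-1) ^ n = 1 := by rw [← mul_pow]; simp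
      linear_combination -(n * a n) * this
    rw [h2, h1, pow_succ, ← mul_assoc, ← mul_assoc, ← mul_pow, neg_one_mul, neg_neg, one_pow,
      one_mul, neg_one_mul, ← Finset.sum_neg_distrib]
    symm
    refine Finset.sum_bij' (fun k _ => (n - k, k)) (fun q _ => q.2) ?_ ?_ ?_ ?_ ?_
    · intro k hk
      rw [Finset.mem_Icc] at hk
      rw [Finset.mem_filter, Finset.HasAntidiagonal.mem_antidiagonal]
      dsimp only
      omega
    · intro q hq
      rw [Finset.mem_filter, Finset.HasAntidiagonal.mem_antidiagonal] at hq
      rw [Finset.mem_Icc]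
      omega
    · intro k _
      rfl
    · rintro ⟨i, j⟩ hq
      rw [Finset.mem_filter, Finset.HasAntidiagonal.mem_antidiagonal] at hq
      dsimp only at hq ⊢
      ext
      · dsimp only
        omega
      · rfl
    · intro k _
      dsimp only
      have : ((-1 : ℂ) ^ (n - k)) * (-1) ^ (n - k) = 1 := by rw [← mul_pow]; simp
      linear_combination (a (n - k) * ∑ i, μ i ^ k) * this
  refine ⟨μ, fun k => ?_⟩
  induction k using Nat.strong_induction_on with
  | _ k ih =>
    intro hk
    have h1 := (hrec k).symm.trans (hnewton k)
    rw [← Finset.Ico_insert_right hk, Finset.sum_insert (by simp), Finset.sum_insert (by simp),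
      Nat.sub_self, ha0, mul_one, mul_one] at h1
    have h2 : ∑ j ∈ Finset.Ico 1 k, s j * a (k - j) =
        ∑ j ∈ Finset.Ico 1 k, (-∑ i, μ i ^ j) * a (k - j) := by
      refine Finset.sum_congr rfl fun j hj => ?_
      rw [Finset.mem_Ico] at hj
      rw [ih j hj.2 hj.1]
    rw [h2] at h1
    exact add_right_cancel h1

/-- The number of solutions of the Artin-Schreier equation. -/
theorem card_filter_pow_sub_self_eq {p : ℕ} [Fact p.Prime] {L : Type*} [Field L]
    [Algebra (ZMod p) L] [Fintype L] [DecidableEq L] (x : L) :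
    (Finset.univ.filter fun z : L => z ^ p - z = x).card =
      if Algebra.trace (ZMod p) L x = 0 then p else 0 := by
  have hfd : FiniteDimensional (ZMod p) L := .of_finite
  have hchar : CharP L p := charP_of_injective_algebraMap (algebraMap (ZMod p) L).injective p
  set φ : L →ₗ[ZMod p] L :=
    (FiniteField.frobeniusAlgHom (ZMod p) L).toLinearMap - LinearMap.id with hφ
  have hφa : ∀ z, φ z = z ^ p - z := by
    intro z
    simp [hφ]
  have hker : (Finset.univ.filter fun z : L => φ z = 0).card = p := by
    refine Eq.trans ?_ (Subfield.card_bot L p)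
    rw [← Fintype.card_subtype, ← Nat.card_eq_fintype_card]
    refine Nat.card_congr (Equiv.subtypeEquivRight fun z => ?_)
    rw [Subfield.mem_bot_iff_pow_eq_self L p, hφa, sub_eq_zero]
  have hkerf : Module.finrank (ZMod p) (LinearMap.ker φ) = 1 := by
    have h1 := Module.natCard_eq_pow_finrank (K := ZMod p) (V := LinearMap.ker φ)
    have h2 : Nat.card (LinearMap.ker φ) = p := by
      refine Eq.trans ?_ hker
      rw [← Fintype.card_subtype, ← Nat.card_eq_fintype_card]
      exact Nat.card_congr (Equiv.subtypeEquivRight fun z => LinearMap.mem_ker)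
    rw [h2, Nat.card_zmod] at h1
    exact (Nat.pow_right_injective (Fact.out : p.Prime).two_le (by simpa using h1)).symm
  have hle : LinearMap.range φ ≤ LinearMap.ker (Algebra.trace (ZMod p) L) := by
    rintro _ ⟨z, rfl⟩
    rw [LinearMap.mem_ker, hφa, map_sub, sub_eq_zero]
    have := Algebra.trace_eq_of_algEquiv
      (FiniteField.frobeniusAlgEquivOfAlgebraic (ZMod p) L) z
    simpa using this
  have hrange : LinearMap.range φ = LinearMap.ker (Algebra.trace (ZMod p) L) := by
    refine Submodule.eq_of_le_of_finrank_eq hle ?_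
    have h1 := LinearMap.finrank_range_add_finrank_ker φ
    have h2 := LinearMap.finrank_range_add_finrank_ker (Algebra.trace (ZMod p) L)
    rw [LinearMap.range_eq_top.2 (Algebra.trace_surjective (ZMod p) L), finrank_top,
      Module.finrank_self] at h2
    omega
  have hset : (Finset.univ.filter fun z : L => z ^ p - z = x) =
      Finset.univ.filter fun z : L => φ z = x :=
    Finset.filter_congr fun z _ => by rw [hφa]
  rw [hset]
  have hmem : Algebra.trace (ZMod p) L x = 0 ↔ x ∈ Set.range φ := by
    rw [← LinearMap.mem_ker, ← hrange]
    rfl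
  split_ifs with h
  · refine Eq.trans ?_ hker
    exact AddMonoidHom.card_fiber_eq_of_mem_range φ (hmem.1 h) ⟨0, map_zero φ⟩
  · rw [Finset.card_eq_zero, Finset.filter_eq_empty_iff]
    exact fun z _ hz => h (hmem.2 ⟨z, hz⟩)

theorem sum_addChar_sum_mul_trace {p : ℕ} [Fact p.Prime] {L : Type*} [Field L]
    [Algebra (ZMod p) L] [Fintype L] (f : L → ℂ) :
    ∑ ψ : AddChar (ZMod p) ℂ, ∑ x : L, f x * ψ (Algebra.trace (ZMod p) L x) =
      ∑ z : L, f (z ^ p - z) := by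
  have hdec : DecidableEq L := Classical.decEq L
  rw [Finset.sum_comm]
  have h1 : ∀ x : L, ∑ ψ : AddChar (ZMod p) ℂ, f x * ψ (Algebra.trace (ZMod p) L x) =
      ∑ z ∈ Finset.univ.filter (fun z : L => z ^ p - z = x), f (z ^ p - z) := by
    intro x
    have h2 : ∑ z ∈ Finset.univ.filter (fun z : L => z ^ p - z = x), f (z ^ p - z) =
        ∑ z ∈ Finset.univ.filter (fun z : L => z ^ p - z = x), f x :=
      Finset.sum_congr rfl fun z hz => by rw [(Finset.mem_filter.1 hz).2]
    rw [h2, Finset.sum_const, card_filter_pow_sub_self_eq (p := p), ← Finset.mul_sum,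
      AddChar.sum_apply_eq_ite, ZMod.card, nsmul_eq_mul, mul_comm]
    split_ifs <;> simp
  rw [Finset.sum_congr rfl fun x _ => h1 x]
  exact Finset.sum_fiberwise Finset.univ (fun z : L => z ^ p - z) fun z => f (z ^ p - z)

open Polynomial in
/-- Complex numbers whose power sums are `O(R ^ n)` have absolute value at most `R`. -/
theorem norm_le_of_norm_sum_pow_le {ι : Type*} [Fintype ι] {μ : ι → ℂ} {c R : ℝ} (hR : 0 < R)
    (h : ∀ n, 1 ≤ n → ‖∑ i, μ i ^ n‖ ≤ c * R ^ n) (i : ι) : ‖μ i‖ ≤ R := by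
  classical
  by_contra! hlt
  set P : ℂ[X] := ∏ β ∈ (Finset.univ.image μ).erase (μ i), (X - C β) with hP
  have hPi : P.eval (μ i) ≠ 0 := by
    rw [hP, eval_prod, Finset.prod_ne_zero_iff]
    intro β hβ
    rw [eval_sub, eval_X, eval_C, sub_ne_zero]
    exact (Finset.ne_of_mem_erase hβ).symm
  have hPj : ∀ j, μ j ≠ μ i → P.eval (μ j) = 0 := by
    intro j hj
    rw [hP, eval_prod]
    refine Finset.prod_eq_zero (i := μ j) ?_ (by simp)
    rw [Finset.mem_erase]
    exact ⟨hj, Finset.mem_image_of_mem _ (Finset.mem_univ _)⟩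
  set m := (Finset.univ.filter fun j => μ j = μ i).card with hm
  have hm1 : 1 ≤ m := Finset.card_pos.2 ⟨i, by simp⟩
  have hc : 0 ≤ c := by
    have := (norm_nonneg _).trans (h 1 le_rfl)
    rw [pow_one] at this
    exact nonneg_of_mul_nonneg_left this hR
  have hsum : ∀ n : ℕ, (m : ℂ) * (P.eval (μ i) * μ i ^ n) =
      ∑ k ∈ Finset.range (P.natDegree + 1), P.coeff k * ∑ j, μ j ^ (k + n) := by
    intro n
    calc (m : ℂ) * (P.eval (μ i) * μ i ^ n) = ∑ j, P.eval (μ j) * μ j ^ n := by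
          rw [← Finset.sum_filter_add_sum_filter_not Finset.univ (fun j => μ j = μ i),
            Finset.sum_congr rfl (g := fun _ => P.eval (μ i) * μ i ^ n), Finset.sum_const,
            nsmul_eq_mul, Finset.sum_eq_zero, add_zero]
          · intro j hj
            rw [hPj j (Finset.mem_filter.1 hj).2, zero_mul]
          · intro j hj
            rw [(Finset.mem_filter.1 hj).2]
      _ = _ := by
          simp_rw [Finset.mul_sum]
          rw [Finset.sum_comm]
          refine Finset.sum_congr rfl fun j _ => ?_
          rw [eval_eq_sum_range, Finset.sum_mul]
          refine Finset.sum_congr rfl fun k _ => ?_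
          rw [pow_add]
          ring
  set B := ∑ k ∈ Finset.range (P.natDegree + 1), ‖P.coeff k‖ * (c * R ^ k) with hB
  have hbound : ∀ n : ℕ, 1 ≤ n → ‖P.eval (μ i)‖ * ‖μ i‖ ^ n ≤ B * R ^ n := by
    intro n hn
    calc ‖P.eval (μ i)‖ * ‖μ i‖ ^ n ≤ m * (‖P.eval (μ i)‖ * ‖μ i‖ ^ n) :=
          le_mul_of_one_le_left (by positivity) (by exact_mod_cast hm1)
      _ = ‖(m : ℂ) * (P.eval (μ i) * μ i ^ n)‖ := by simp
      _ ≤ ∑ k ∈ Finset.range (P.natDegree + 1), ‖P.coeff k‖ * (c * R ^ (k + n)) := by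
          rw [hsum n]
          refine (norm_sum_le _ _).trans (Finset.sum_le_sum fun k _ => ?_)
          rw [norm_mul]
          exact mul_le_mul_of_nonneg_left (h _ (by omega)) (norm_nonneg _)
      _ = B * R ^ n := by
          rw [hB, Finset.sum_mul]
          refine Finset.sum_congr rfl fun k _ => ?_
          rw [pow_add]
          ring
  have hratio : 1 < ‖μ i‖ / R := (one_lt_div hR).2 hlt
  obtain ⟨n, hn⟩ := pow_unbounded_of_one_lt (B / ‖P.eval (μ i)‖) hratio
  have hPn : 0 < ‖P.eval (μ i)‖ := norm_pos_iff.2 hPi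
  have h1 := hbound (n + 1) (by omega)
  have h2 : B / ‖P.eval (μ i)‖ < (‖μ i‖ / R) ^ (n + 1) :=
    hn.trans_le (pow_le_pow_right₀ hratio.le (Nat.le_succ n))
  rw [div_pow, div_lt_div_iff₀ hPn (by positivity)] at h2
  linarith

/-- A function whose fibres over nonzero residues are not too large has small character sums. -/
theorem norm_sum_mulChar_comp_le {p : ℕ} [Fact p.Prime] {K : Type*} [Fintype K]
    {χ : MulChar (ZMod p) ℂ} (hχ : χ ≠ 1) (f : K → ZMod p) {U : ℝ}
    (hU : ∀ a, a ≠ 0 → ((Finset.univ.filter fun z => f z = a).card : ℝ) ≤ U) :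
    ‖∑ z, χ (f z)‖ ≤ (p - 1) * U - Fintype.card K + (Finset.univ.filter fun z => f z = 0).card := by
  set N : ZMod p → ℝ := fun a => ((Finset.univ.filter fun z => f z = a).card : ℝ) with hN
  have h1 : ∑ z, χ (f z) = ∑ a, χ a * ((N a : ℝ) : ℂ) := by
    rw [← Finset.sum_fiberwise Finset.univ f]
    refine Finset.sum_congr rfl fun a _ => ?_
    rw [Finset.sum_congr rfl (g := fun _ => χ a), Finset.sum_const, nsmul_eq_mul, mul_comm]
    · simp [hN]
    · intro z hz
      rw [(Finset.mem_filter.1 hz).2]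
  have h2 : ∑ a, χ a * ((N a : ℝ) : ℂ) = ∑ a, χ a * ((N a - U : ℝ) : ℂ) := by
    simp only [Complex.ofReal_sub, mul_sub, Finset.sum_sub_distrib, ← Finset.sum_mul,
      MulChar.sum_eq_zero_of_ne_one hχ, zero_mul, sub_zero]
  have h3 : ∑ a, N a = Fintype.card K := by
    rw [hN, ← Nat.cast_sum, ← Finset.card_eq_sum_card_fiberwise (by simp), Finset.card_univ]
  rw [h1, h2, ← Finset.add_sum_erase _ _ (Finset.mem_univ (0 : ZMod p)), MulChar.map_zero,
    zero_mul, zero_add]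
  have h4 : ∀ a ∈ Finset.univ.erase (0 : ZMod p), ‖χ a * ((N a - U : ℝ) : ℂ)‖ ≤ U - N a := by
    intro a ha
    have ha' := Finset.ne_of_mem_erase ha
    have h5 : N a - U ≤ 0 := sub_nonpos.2 (hU a ha')
    rw [norm_mul, Complex.norm_real, Real.norm_of_nonpos h5, neg_sub]
    refine mul_le_of_le_one_left (by linarith) ?_
    exact DirichletCharacter.norm_le_one χ a
  refine (norm_sum_le _ _).trans ((Finset.sum_le_sum h4).trans (le_of_eq ?_))
  rw [Finset.sum_sub_distrib, Finset.sum_const, Finset.card_erase_of_mem (Finset.mem_univ _),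
    Finset.card_univ, ZMod.card, nsmul_eq_mul, Nat.cast_pred (Fact.out : p.Prime).pos, ← h3,
    ← Finset.add_sum_erase _ _ (Finset.mem_univ (0 : ZMod p))]
  simp only [hN]
  ring

open Polynomial in
theorem norm_sum_mulChar_norm_le {p : ℕ} [Fact p.Prime] {χ : MulChar (ZMod p) ℂ} (hχ : χ ≠ 1)
    {T : Finset (ZMod p)} (h0 : 0 ∈ T) {K : Type*} [Field K] [Fintype K] [Algebra (ZMod p) K]
    {n : ℕ} (hn : 1 ≤ n) (hcard : Fintype.card K = (p ^ n) ^ 2) :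
    ‖∑ z : K, χ (Algebra.norm (ZMod p)
        (∏ t ∈ T, (algebraMap (ZMod p) K t - (z ^ p - z))))‖ ≤
      (((p - 1) * (5 * (p * T.card) + 2) + p * T.card : ℕ) : ℝ) * p ^ n := by
  have hp : p.Prime := Fact.out
  have hdec : DecidableEq K := Classical.decEq K
  have hfd : FiniteDimensional (ZMod p) K := .of_finite
  set h : K[X] := ∏ t ∈ T, (C (algebraMap (ZMod p) K t) - (X ^ p - X)) with hh
  set u : K[X] := (1 - X ^ (p - 1)) *
    ∏ t ∈ T.erase 0, (C (algebraMap (ZMod p) K t) - (X ^ p - X)) with hu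
  have hev : ∀ z, h.eval z = ∏ t ∈ T, (algebraMap (ZMod p) K t - (z ^ p - z)) := by
    intro z
    simp [hh, eval_prod]
  have hhu : h = X * u := by
    rw [hh, hu, ← Finset.mul_prod_erase _ _ h0, ← mul_assoc, mul_sub, mul_one, ← pow_succ',
      Nat.sub_add_cancel hp.one_le]
    simp
  have hu0 : u.coeff 0 ≠ 0 := by
    rw [coeff_zero_eq_eval_zero, hu, eval_mul, eval_prod]
    refine mul_ne_zero ?_ (Finset.prod_ne_zero_iff.2 fun t ht => ?_)
    · have : p - 1 ≠ 0 := by have := hp.two_le; omega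
      simp [this]
    · have := Finset.ne_of_mem_erase ht
      simpa [hp.ne_zero] using this
  have hh0 : h ≠ 0 := by
    rw [hhu]
    refine mul_ne_zero X_ne_zero ?_
    rintro h1
    simp [h1] at hu0
  have hdeg : h.natDegree ≤ p * T.card := by
    refine (natDegree_prod_le _ _).trans ?_
    refine le_trans ?_ (mul_comm T.card p).le
    refine Finset.sum_le_card_nsmul _ _ _ fun t _ => ?_
    refine (natDegree_sub_le _ _).trans (max_le (by simp) ?_)
    rw [FiniteField.X_pow_card_sub_X_natDegree_eq _ hp.one_lt]
  have hp2 : 2 ≤ p ^ n := hp.two_le.trans (Nat.le_self_pow (by omega) p)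
  have hdvd : p - 1 ∣ p ^ n - 1 := by
    simpa using Nat.sub_dvd_pow_sub_pow p 1 n
  have hTc : 1 ≤ T.card := Finset.card_pos.2 ⟨0, h0⟩
  have hm1 : 1 ≤ p * T.card := Nat.mul_pos hp.pos hTc
  have hD : 0 < p - 1 := Nat.sub_pos_of_lt hp.one_lt
  have hnorm : ∀ z a, Algebra.norm (ZMod p) (h.eval z) = a ↔
      h.eval z ^ (((p ^ n) ^ 2 - 1) / (p - 1)) = algebraMap (ZMod p) K a := by
    intro z a
    rw [← (algebraMap (ZMod p) K).injective.eq_iff, FiniteField.algebraMap_norm_eq_pow,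
      Nat.card_zmod, Nat.card_eq_fintype_card, hcard]
  set U : ℝ := ((p ^ n : ℕ) ^ 2 + (p - 1) * (5 * (p * T.card : ℕ) + 2) * (p ^ n : ℕ)) / (p - 1)
    with hU
  have hDr : (0 : ℝ) < p - 1 := by
    have : (1 : ℝ) < p := by exact_mod_cast hp.one_lt
    linarith
  have hmain := norm_sum_mulChar_comp_le hχ (fun z => Algebra.norm (ZMod p) (h.eval z)) (U := U) (by
    intro a _
    rw [hU, le_div_iff₀ hDr, mul_comm]
    have := stepanov_card_le hp2 hcard hD hdvd hm1 h u hdeg hhu hu0 (algebraMap (ZMod p) K a)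
    rw [← Finset.filter_congr fun z _ => hnorm z a] at this
    have h2 : (((p - 1 : ℕ) : ℝ)) = p - 1 := Nat.cast_pred hp.pos
    rw [← h2]
    exact_mod_cast this)
  have hzero : (Finset.univ.filter fun z => Algebra.norm (ZMod p) (h.eval z) = 0).card ≤
      p * T.card := by
    refine (Finset.card_le_card (t := h.roots.toFinset) ?_).trans
      ((Multiset.toFinset_card_le _).trans ((card_roots' h).trans hdeg))
    intro z hz
    rw [Finset.mem_filter, Algebra.norm_eq_zero_iff] at hz
    rw [Multiset.mem_toFinset, mem_roots hh0]
    exact hz.2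
  simp only [hev] at hmain hzero
  refine hmain.trans ?_
  rw [hU, mul_div_cancel₀ _ hDr.ne', hcard]
  have hz' : ((Finset.univ.filter fun z => Algebra.norm (ZMod p)
      (∏ t ∈ T, (algebraMap (ZMod p) K t - (z ^ p - z))) = 0).card : ℝ) ≤
      ((p * T.card : ℕ) : ℝ) * (p ^ n : ℕ) := by
    refine le_trans (Nat.cast_le.2 hzero) (le_mul_of_one_le_right (Nat.cast_nonneg _) ?_)
    exact_mod_cast hp2.trans' one_le_two
  push_cast [Nat.cast_pred hp.pos] at hz' ⊢
  linarith

/-- **Weil's bound** for mixed sums of a multiplicative character of a product of distinct linear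
factors and an additive character. -/
theorem norm_sum_mulChar_prod_mul_addChar_le {p : ℕ} [Fact p.Prime] {χ : MulChar (ZMod p) ℂ}
    (hχ : χ ≠ 1) (ψ : AddChar (ZMod p) ℂ) {T : Finset (ZMod p)} (h0 : 0 ∈ T) :
    ‖∑ c, χ (∏ t ∈ T, (t - c)) * ψ c‖ ≤ T.card * √p := by
  have hp : p.Prime := Fact.out
  have hrec : ∀ (φ : AddChar (ZMod p) ℂ) (n : ℕ), (n : ℂ) * lCoeff χ φ T n =
      ∑ k ∈ Finset.Icc 1 n, (∑ x : GaloisField p k, charWeight χ φ T (conjPoly (ZMod p) x)) *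
        lCoeff χ φ T (n - k) := fun φ n =>
    natCast_mul_sum_monicsOfDegree (charWeight_mul χ φ T) n
  have hex := fun φ => exists_power_sums_of_recursion (d := T.card) (lCoeff_zero χ φ T)
    (fun n hn => lCoeff_eq_zero φ hχ ⟨0, h0⟩ hn) (hrec φ)
  choose μ hμ using hex
  set c : ℝ := (((p - 1) * (5 * (p * T.card) + 2) + p * T.card : ℕ) : ℝ) with hc
  have hbound : ∀ n, 1 ≤ n →
      ‖∑ i : AddChar (ZMod p) ℂ × Fin T.card, (μ i.1 i.2 ^ 2) ^ n‖ ≤ c * (p : ℝ) ^ n := by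
    intro n hn
    have hfd : FiniteDimensional (ZMod p) (GaloisField p (2 * n)) := .of_finite
    have h1 : ∑ i : AddChar (ZMod p) ℂ × Fin T.card, (μ i.1 i.2 ^ 2) ^ n =
        -∑ z : GaloisField p (2 * n), χ (Algebra.norm (ZMod p)
        (∏ t ∈ T, (algebraMap (ZMod p) (GaloisField p (2 * n)) t - (z ^ p - z)))) := by
      rw [← sum_addChar_sum_mul_trace fun x => χ (Algebra.norm (ZMod p)
        (∏ t ∈ T, (algebraMap (ZMod p) (GaloisField p (2 * n)) t - x))),
        Fintype.sum_prod_type, ← Finset.sum_neg_distrib]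
      refine Finset.sum_congr rfl fun φ _ => ?_
      simp only [← pow_mul]
      rw [← neg_eq_iff_eq_neg, ← hμ φ (2 * n) (by omega)]
      simp only [charWeight_conjPoly]
    rw [h1, norm_neg]
    refine norm_sum_mulChar_norm_le hχ h0 hn ?_
    rw [← Nat.card_eq_fintype_card, GaloisField.card p _ (by omega), ← pow_mul, mul_comm]
  have hle : ∀ i, ‖μ ψ i‖ ≤ √p := by
    intro i
    refine Real.le_sqrt_of_sq_le ?_
    rw [← norm_pow]
    exact norm_le_of_norm_sum_pow_le (by exact_mod_cast hp.pos) hbound (ψ, i)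
  have h1 := hrec ψ 1
  rw [Finset.Icc_self, Finset.sum_singleton, hμ ψ 1 le_rfl, Nat.sub_self, lCoeff_zero,
    lCoeff_one, Nat.cast_one, one_mul, mul_one] at h1
  rw [h1, norm_neg]
  refine (norm_sum_le _ _).trans ((Finset.sum_le_card_nsmul _ _ (√p) fun i _ => ?_).trans ?_)
  · rw [pow_one]
    exact hle i
  · simp

theorem norm_sum_mulChar_prod_add_mul_addChar_le {p : ℕ} [Fact p.Prime] {χ : MulChar (ZMod p) ℂ}
    (hχ : χ ≠ 1) (ψ : AddChar (ZMod p) ℂ) {k : ℕ} (hk : 1 ≤ k) (hkp : k ≤ p) :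
    ‖∑ x : ZMod p, χ (∏ i ∈ Finset.range k, (x + 1 + i)) * ψ x‖ ≤ k * √p := by
  have hinj : Set.InjOn (fun i : ℕ => (i : ZMod p)) (Finset.range k) := by
    intro i hi j hj hij
    rw [Finset.coe_range, Set.mem_Iio] at hi hj
    have h1 := (ZMod.natCast_eq_natCast_iff' i j p).1 hij
    rwa [Nat.mod_eq_of_lt (hi.trans_le hkp), Nat.mod_eq_of_lt (hj.trans_le hkp)] at h1
  set T : Finset (ZMod p) := (Finset.range k).image fun i : ℕ => (i : ZMod p) with hT
  have h0 : (0 : ZMod p) ∈ T :=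
    Finset.mem_image.2 ⟨0, Finset.mem_range.2 hk, Nat.cast_zero⟩
  have hcard : T.card = k := by
    rw [hT, Finset.card_image_of_injOn hinj, Finset.card_range]
  have h1 := norm_sum_mulChar_prod_mul_addChar_le hχ ψ⁻¹ h0
  rw [hcard] at h1
  refine le_trans (le_of_eq ?_) h1
  have h2 : ∑ c, χ (∏ t ∈ T, (t - c)) * ψ⁻¹ c =
      ψ 1 * ∑ x : ZMod p, χ (∏ i ∈ Finset.range k, (x + 1 + i)) * ψ x := by
    rw [Finset.mul_sum]
    refine Fintype.sum_equiv ((Equiv.neg (ZMod p)).trans (Equiv.subRight 1)) _ _ fun c => ?_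
    have h3 : ∏ t ∈ T, (t - c) = ∏ i ∈ Finset.range k, ((-c - 1) + 1 + (i : ZMod p)) := by
      rw [hT, Finset.prod_image hinj]
      exact Finset.prod_congr rfl fun i _ => by ring
    have h4 : ψ⁻¹ c = ψ 1 * ψ (-c - 1) := by
      rw [AddChar.inv_apply, ← AddChar.map_add_eq_mul]
      congr 1
      ring
    simp only [Equiv.trans_apply, Equiv.neg_apply, Equiv.subRight_apply]
    rw [h3, h4]
    ring
  rw [h2, norm_mul, AddChar.norm_apply, one_mul]

theorem norm_geom_sum_zmod_le {p : ℕ} [Fact p.Prime] {b : ℕ} (hb : 1 ≤ b) (hbp : b < p) (M : ℕ) :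
    ‖∑ m ∈ Finset.range M, AddChar.zmodAddEquiv (b : ZMod p) (m : ZMod p)‖ ≤
      p / 2 * ((b : ℝ)⁻¹ + ((p - b : ℕ) : ℝ)⁻¹) := by
  have hp0 : (0 : ℝ) < p := by exact_mod_cast (Nat.zero_lt_of_lt hbp)
  have hb0 : (0 : ℝ) < b := by exact_mod_cast hb
  have hpb0 : (0 : ℝ) < (p - b : ℕ) := by exact_mod_cast Nat.sub_pos_of_lt hbp
  have hpb : ((p - b : ℕ) : ℝ) = p - b := Nat.cast_sub hbp.le
  set ω : ℂ := AddChar.zmodAddEquiv (b : ZMod p) 1 with hω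
  have hpow : ∀ m : ℕ, AddChar.zmodAddEquiv (b : ZMod p) (m : ZMod p) = ω ^ m := by
    intro m
    rw [hω, ← AddChar.map_nsmul_eq_pow, nsmul_one]
  have hωexp : ω = Complex.exp (Complex.I * ((2 * Real.pi * (b / p) : ℝ) : ℂ)) := by
    have h1 := AddChar.zmod_intCast p b 1
    simp only [Int.cast_natCast, Int.cast_one, mul_one] at h1
    have h2 : ω = (AddChar.zmod p (b : ZMod p) 1 : Circle) := rfl
    rw [h2, h1, Circle.coe_exp, mul_comm]
  have hsin : 0 < Real.sin (Real.pi * (b / p)) ∧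
      (Real.sin (Real.pi * (b / p)))⁻¹ ≤ p / 2 * ((b : ℝ)⁻¹ + ((p - b : ℕ) : ℝ)⁻¹) := by
    have key : ∀ x : ℝ, 0 < x → x / p ≤ 1 / 2 → 0 < Real.sin (Real.pi * (x / p)) ∧
        (Real.sin (Real.pi * (x / p)))⁻¹ ≤ p / 2 * x⁻¹ := by
      intro x hx hxp
      have h1 := Real.mul_le_sin (x := Real.pi * (x / p)) (by positivity)
        (by nlinarith [Real.pi_pos])
      have h2 : 2 / Real.pi * (Real.pi * (x / p)) = 2 * (x / p) := by
        field_simp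
      rw [h2] at h1
      have h3 : 0 < 2 * (x / p) := by positivity
      refine ⟨h3.trans_le h1, (inv_anti₀ h3 h1).trans (le_of_eq ?_)⟩
      field_simp
    rcases le_total ((b : ℝ) / p) (1 / 2) with h | h
    · obtain ⟨h1, h2⟩ := key b hb0 h
      refine ⟨h1, h2.trans (mul_le_mul_of_nonneg_left ?_ (by positivity))⟩
      exact le_add_of_nonneg_right (by positivity)
    · have h3 : ((p - b : ℕ) : ℝ) / p = 1 - b / p := by
        rw [hpb]
        field_simp
      obtain ⟨h1, h2⟩ := key (p - b : ℕ) hpb0 (by rw [h3]; linarith)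
      have h4 : Real.sin (Real.pi * (((p - b : ℕ) : ℝ) / p)) = Real.sin (Real.pi * (b / p)) := by
        rw [h3, mul_sub, mul_one, Real.sin_pi_sub]
      rw [h4] at h1 h2
      refine ⟨h1, h2.trans (mul_le_mul_of_nonneg_left ?_ (by positivity))⟩
      exact le_add_of_nonneg_left (by positivity)
  have hnorm : ‖ω - 1‖ = 2 * Real.sin (Real.pi * (b / p)) := by
    rw [hωexp, Complex.norm_exp_I_mul_ofReal_sub_one, Real.norm_of_nonneg]
    · congr 2
      ring
    · have : 2 * Real.pi * (b / p) / 2 = Real.pi * ((b : ℝ) / p) := by ring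
      rw [this]
      linarith [hsin.1]
  have hω1 : ω ≠ 1 := by
    rintro h
    rw [h, sub_self, norm_zero] at hnorm
    linarith [hsin.1]
  have hωn : ‖ω‖ = 1 := AddChar.norm_apply _ _
  rw [Finset.sum_congr rfl fun m _ => hpow m, geom_sum_eq hω1, norm_div, hnorm]
  refine le_trans ?_ hsin.2
  rw [inv_eq_one_div, div_le_div_iff₀ (by linarith [hsin.1]) hsin.1, one_mul]
  refine mul_le_mul_of_nonneg_right ?_ hsin.1.le
  refine (norm_sub_le _ _).trans ?_
  rw [norm_pow, hωn, one_pow, norm_one]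
  norm_num

theorem sum_norm_sum_addChar_le {p : ℕ} [Fact p.Prime] {M : ℕ} (hM : M ≤ p) :
    ∑ ψ : AddChar (ZMod p) ℂ, ‖∑ m ∈ Finset.range M, ψ (m : ZMod p)‖ ≤ p * (2 + Real.log p) := by
  have hp : p.Prime := Fact.out
  have h1 : ∑ ψ : AddChar (ZMod p) ℂ, ‖∑ m ∈ Finset.range M, ψ (m : ZMod p)‖ =
      ∑ b ∈ Finset.range p,
        ‖∑ m ∈ Finset.range M, AddChar.zmodAddEquiv (b : ZMod p) (m : ZMod p)‖ := by
    rw [← (AddChar.zmodAddEquiv (n := p)).toEquiv.sum_comp]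
    refine Finset.sum_nbij' ZMod.val (fun b => (b : ZMod p)) ?_ ?_ ?_ ?_ ?_
    · exact fun b _ => Finset.mem_range.2 (ZMod.val_lt b)
    · exact fun b _ => Finset.mem_univ _
    · exact fun b _ => ZMod.natCast_zmod_val b
    · exact fun b hb => ZMod.val_cast_of_lt (Finset.mem_range.1 hb)
    · intro b _
      simp
  have h2 : ∀ n : ℕ, ((harmonic n : ℚ) : ℝ) = ∑ i ∈ Finset.range n, (((i + 1 : ℕ) : ℝ))⁻¹ := by
    intro n
    simp [harmonic]
  obtain ⟨q, rfl⟩ : ∃ q, p = q + 1 := ⟨p - 1, (Nat.sub_add_cancel hp.one_le).symm⟩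
  rw [h1, Finset.sum_range_succ']
  have h3 : ∑ b ∈ Finset.range q, ‖∑ m ∈ Finset.range M,
      AddChar.zmodAddEquiv ((b + 1 : ℕ) : ZMod (q + 1)) (m : ZMod (q + 1))‖ ≤
      ∑ b ∈ Finset.range q, (((q + 1 : ℕ) : ℝ) / 2) *
        ((((b + 1 : ℕ) : ℝ))⁻¹ + (((q - 1 - b) + 1 : ℕ) : ℝ)⁻¹) := by
    refine Finset.sum_le_sum fun b hb => ?_
    rw [Finset.mem_range] at hb
    have := norm_geom_sum_zmod_le (p := q + 1) (b := b + 1) (by omega) (by omega) M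
    have h4 : q + 1 - (b + 1) = q - 1 - b + 1 := by omega
    rwa [h4] at this
  have h5 : ‖∑ m ∈ Finset.range M,
      AddChar.zmodAddEquiv ((0 : ℕ) : ZMod (q + 1)) (m : ZMod (q + 1))‖ ≤ (q + 1 : ℕ) := by
    refine (norm_sum_le _ _).trans ?_
    rw [Finset.sum_congr rfl fun m _ => AddChar.norm_apply _ _]
    simp only [Finset.sum_const, Finset.card_range, nsmul_eq_mul, mul_one]
    exact_mod_cast hM
  have h6 : ∑ b ∈ Finset.range q, (((q + 1 : ℕ) : ℝ) / 2) *
        ((((b + 1 : ℕ) : ℝ))⁻¹ + (((q - 1 - b) + 1 : ℕ) : ℝ)⁻¹) =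
        ((q + 1 : ℕ) : ℝ) * ((harmonic q : ℚ) : ℝ) := by
    rw [← Finset.mul_sum, Finset.sum_add_distrib,
      Finset.sum_range_reflect (fun b => (((b + 1 : ℕ) : ℝ))⁻¹), ← h2]
    ring
  have h7 : ((harmonic q : ℚ) : ℝ) ≤ 1 + Real.log (q + 1 : ℕ) := by
    refine (harmonic_le_one_add_log q).trans (add_le_add_right ?_ _)
    have hq : 0 < q := by have := hp.two_le; omega
    exact Real.log_le_log (by exact_mod_cast hq) (by exact_mod_cast Nat.le_succ q)
  have h8 := mul_le_mul_of_nonneg_left h7 (Nat.cast_nonneg (α := ℝ) (q + 1))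
  have h9 := add_le_add (h3.trans (h6.le.trans h8)) h5
  refine h9.trans (le_of_eq ?_)
  ring

/-- The Pólya-Vinogradov bound for the character sums of products of consecutive integers. -/
theorem norm_sum_range_mulChar_prod_le {p : ℕ} [Fact p.Prime] (hp3 : 3 ≤ p)
    {χ : MulChar (ZMod p) ℂ} (hχ : χ ≠ 1) {k : ℕ} (hk : 1 ≤ k) (hkp : k ≤ p) (a : ℕ) {M : ℕ}
    (hM : M ≤ p) :
    ‖∑ m ∈ Finset.range M, χ (∏ i ∈ Finset.range k, (((a + m : ℕ) : ZMod p) + 1 + i))‖ ≤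
      3 * k * √p * Real.log p := by
  have hp0 : (0 : ℝ) < p := by exact_mod_cast (by omega : 0 < p)
  have hlog : 1 ≤ Real.log p := by
    rw [Real.le_log_iff_exp_le hp0]
    have h1 := Real.exp_one_lt_d9
    have h2 : (3 : ℝ) ≤ p := by exact_mod_cast hp3
    linarith
  set f : ZMod p → ℂ := fun x => χ (∏ i ∈ Finset.range k, (x + 1 + i)) with hf
  have hcomp : (p : ℂ) * ∑ m ∈ Finset.range M, f ((a + m : ℕ) : ZMod p) =
      ∑ ψ : AddChar (ZMod p) ℂ, ψ⁻¹ (a : ZMod p) * (∑ m ∈ Finset.range M, ψ⁻¹ (m : ZMod p)) *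
        ∑ x, f x * ψ x := by
    have h1 : ∀ y : ZMod p, (p : ℂ) * f y =
        ∑ ψ : AddChar (ZMod p) ℂ, ψ⁻¹ y * ∑ x, f x * ψ x := by
      intro y
      simp_rw [Finset.mul_sum]
      rw [Finset.sum_comm]
      have h2 : ∀ x, ∑ ψ : AddChar (ZMod p) ℂ, ψ⁻¹ y * (f x * ψ x) =
          if x = y then (p : ℂ) * f x else 0 := by
        intro x
        have h3 : ∀ ψ : AddChar (ZMod p) ℂ, ψ⁻¹ y * (f x * ψ x) = f x * ψ (x - y) := by
          intro ψ
          rw [AddChar.inv_apply, sub_eq_add_neg, AddChar.map_add_eq_mul]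
          ring
        rw [Finset.sum_congr rfl fun ψ _ => h3 ψ, ← Finset.mul_sum, AddChar.sum_apply_eq_ite,
          ZMod.card]
        simp only [sub_eq_zero]
        split_ifs <;> ring
      rw [Finset.sum_congr rfl fun x _ => h2 x]
      simp
    rw [Finset.mul_sum, Finset.sum_congr rfl fun m _ => h1 _, Finset.sum_comm]
    refine Finset.sum_congr rfl fun ψ _ => ?_
    rw [← Finset.sum_mul]
    congr 1
    rw [Finset.mul_sum]
    refine Finset.sum_congr rfl fun m _ => ?_
    rw [Nat.cast_add, AddChar.map_add_eq_mul]
  have h4 : (p : ℝ) * ‖∑ m ∈ Finset.range M, f ((a + m : ℕ) : ZMod p)‖ ≤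
      (p * (2 + Real.log p)) * (k * √p) := by
    calc (p : ℝ) * ‖∑ m ∈ Finset.range M, f ((a + m : ℕ) : ZMod p)‖ =
        ‖(p : ℂ) * ∑ m ∈ Finset.range M, f ((a + m : ℕ) : ZMod p)‖ := by
          rw [norm_mul, Complex.norm_natCast]
      _ ≤ ∑ ψ : AddChar (ZMod p) ℂ, ‖∑ m ∈ Finset.range M, ψ⁻¹ (m : ZMod p)‖ * (k * √p) := by
          rw [hcomp]
          refine (norm_sum_le _ _).trans (Finset.sum_le_sum fun ψ _ => ?_)
          rw [norm_mul, norm_mul, AddChar.norm_apply, one_mul]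
          exact mul_le_mul_of_nonneg_left
            (norm_sum_mulChar_prod_add_mul_addChar_le hχ ψ hk hkp) (norm_nonneg _)
      _ = (∑ ψ : AddChar (ZMod p) ℂ, ‖∑ m ∈ Finset.range M, ψ (m : ZMod p)‖) * (k * √p) := by
          rw [← Finset.sum_mul]
          congr 1
          exact Equiv.sum_comp (Equiv.inv (AddChar (ZMod p) ℂ))
            fun ψ : AddChar (ZMod p) ℂ => ‖∑ m ∈ Finset.range M, ψ (m : ZMod p)‖
      _ ≤ _ := mul_le_mul_of_nonneg_right (sum_norm_sum_addChar_le hM) (by positivity)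
  rw [mul_assoc] at h4
  refine (le_of_mul_le_mul_left h4 hp0).trans ?_
  have h5 : (0 : ℝ) ≤ k * √p := by positivity
  nlinarith

theorem sum_range_sum_range_eq_of_symm {F : ℕ → ℕ → ℝ} (hF : ∀ m n, F m n = F n m) (N : ℕ) :
    ∑ m ∈ Finset.range N, ∑ n ∈ Finset.range N, F m n =
      ∑ n ∈ Finset.range N, F n n +
        2 * ∑ m ∈ Finset.range N, ∑ n ∈ Finset.range m, F m n := by
  induction N with
  | zero => simp
  | succ N ih =>
    simp only [Finset.sum_range_succ, Finset.sum_add_distrib, ih]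
    rw [Finset.sum_congr rfl fun m _ => hF m N]
    ring

theorem sum_range_sum_range_lt_eq {F : ℕ → ℕ → ℝ} {N K : ℕ}
    (hF : ∀ m n, n + K ≤ m → F m n = 0) :
    ∑ m ∈ Finset.range N, ∑ n ∈ Finset.range m, F m n =
      ∑ k ∈ Finset.Ico 1 K, ∑ n ∈ Finset.range (N - k), F (n + k) n := by
  have h1 : ∀ m, ∑ n ∈ Finset.range m, F m n =
      ∑ n ∈ (Finset.range m).filter (fun n => m < n + K), F m n := by
    intro m
    rw [Finset.sum_filter]
    refine Finset.sum_congr rfl fun n _ => ?_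
    split_ifs with h
    · rfl
    · exact hF m n (not_lt.1 h)
  rw [Finset.sum_congr rfl fun m _ => h1 m, Finset.sum_sigma', Finset.sum_sigma']
  refine Finset.sum_nbij' (fun q => ⟨q.1 - q.2, q.2⟩) (fun q => ⟨q.2 + q.1, q.2⟩) ?_ ?_ ?_ ?_ ?_
  · rintro ⟨m, n⟩ h
    simp only [Finset.mem_sigma, Finset.mem_range, Finset.mem_filter, Finset.mem_Ico] at h ⊢
    omega
  · rintro ⟨k, n⟩ h
    simp only [Finset.mem_sigma, Finset.mem_range, Finset.mem_filter, Finset.mem_Ico] at h ⊢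
    omega
  · rintro ⟨m, n⟩ h
    simp only [Finset.mem_sigma, Finset.mem_range, Finset.mem_filter] at h
    simp only [Sigma.mk.injEq, heq_eq_eq, and_true]
    omega
  · rintro ⟨k, n⟩ _
    simp
  · rintro ⟨m, n⟩ h
    simp only [Finset.mem_sigma, Finset.mem_range, Finset.mem_filter] at h
    have h2 : n + (m - n) = m := by omega
    simp only [h2]

theorem card_filter_range_window {N K m n : ℕ} (hm : m < N) (hnm : n ≤ m) :
    ((Finset.range (N + K)).filter fun i => (m ≤ i ∧ i < m + K) ∧ (n ≤ i ∧ i < n + K)).card =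
      K - (m - n) := by
  have h1 : ((Finset.range (N + K)).filter
      fun i => (m ≤ i ∧ i < m + K) ∧ (n ≤ i ∧ i < n + K)) = Finset.Ico m (n + K) := by
    ext i
    simp only [Finset.mem_filter, Finset.mem_range, Finset.mem_Ico]
    omega
  rw [h1, Nat.card_Ico]
  omega

open ComplexConjugate in
/-- The van der Corput inequality. -/
theorem vanDerCorput {N K : ℕ} (hKN : K ≤ N) {b : ℕ → ℂ} (hb : ∀ n, ‖b n‖ ≤ 1) :
    (K : ℝ) ^ 2 * ‖∑ n ∈ Finset.range N, b n‖ ^ 2 ≤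
      2 * N * (K * N + 2 * ∑ k ∈ Finset.Ico 1 K, ((K - k : ℕ) : ℝ) *
        (∑ n ∈ Finset.range (N - k), b (n + k) * conj (b n)).re) := by
  set W : ℕ → ℂ := fun i => ∑ n ∈ Finset.range N, if n ≤ i ∧ i < n + K then b n else 0 with hW
  have hWsum : ∑ i ∈ Finset.range (N + K), W i = K * ∑ n ∈ Finset.range N, b n := by
    rw [hW, Finset.sum_comm, Finset.mul_sum]
    refine Finset.sum_congr rfl fun n hn => ?_
    rw [← Finset.sum_filter, Finset.sum_const, nsmul_eq_mul]
    have := card_filter_range_window (K := K) (Finset.mem_range.1 hn) le_rfl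
    simp only [and_self, Nat.sub_self, Nat.sub_zero] at this
    rw [this]
  have hcs : ‖∑ i ∈ Finset.range (N + K), W i‖ ^ 2 ≤
      ((N + K : ℕ) : ℝ) * ∑ i ∈ Finset.range (N + K), ‖W i‖ ^ 2 := by
    refine (pow_le_pow_left₀ (norm_nonneg _) (norm_sum_le _ _) 2).trans ?_
    have := sq_sum_le_card_mul_sum_sq (s := Finset.range (N + K)) (f := fun i => ‖W i‖)
    rwa [Finset.card_range] at this
  set w : ℕ → ℕ → ℝ := fun m n => (((Finset.range (N + K)).filter
    fun i => (m ≤ i ∧ i < m + K) ∧ (n ≤ i ∧ i < n + K)).card : ℝ) with hw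
  set F : ℕ → ℕ → ℝ := fun m n => w m n * (b m * conj (b n)).re with hFdef
  have hwsymm : ∀ m n, w m n = w n m := by
    intro m n
    simp only [hw]
    congr 2
    refine Finset.filter_congr fun i _ => ?_
    rw [and_comm]
  have hFsymm : ∀ m n, F m n = F n m := by
    intro m n
    simp only [hFdef, hwsymm m n, Complex.mul_re, Complex.conj_re, Complex.conj_im]
    ring
  have hexp : ∑ i ∈ Finset.range (N + K), ‖W i‖ ^ 2 =
      ∑ m ∈ Finset.range N, ∑ n ∈ Finset.range N, F m n := by
    have h1 : ∀ i, ‖W i‖ ^ 2 = ∑ m ∈ Finset.range N, ∑ n ∈ Finset.range N,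
        if (m ≤ i ∧ i < m + K) ∧ (n ≤ i ∧ i < n + K) then (b m * conj (b n)).re else 0 := by
      intro i
      have h2 : ‖W i‖ ^ 2 = (W i * conj (W i)).re := by
        rw [Complex.mul_conj, Complex.ofReal_re, Complex.normSq_eq_norm_sq]
      rw [h2]
      simp only [hW, map_sum, Finset.sum_mul_sum, Complex.re_sum]
      refine Finset.sum_congr rfl fun m _ => Finset.sum_congr rfl fun n _ => ?_
      split_ifs <;> simp_all
    rw [Finset.sum_congr rfl fun i _ => h1 i, Finset.sum_comm]
    refine Finset.sum_congr rfl fun m _ => ?_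
    rw [Finset.sum_comm]
    refine Finset.sum_congr rfl fun n _ => ?_
    rw [← Finset.sum_filter, Finset.sum_const, nsmul_eq_mul]
  have hFzero : ∀ m n, n + K ≤ m → F m n = 0 := by
    intro m n h
    have : w m n = 0 := by
      simp only [hw, Nat.cast_eq_zero, Finset.card_eq_zero, Finset.filter_eq_empty_iff]
      intro i _
      omega
    simp [hFdef, this]
  rw [sum_range_sum_range_eq_of_symm hFsymm, sum_range_sum_range_lt_eq hFzero] at hexp
  have hdiag : ∑ n ∈ Finset.range N, F n n ≤ K * N := by
    have h1 : ∀ n ∈ Finset.range N, F n n ≤ K := by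
      intro n hn
      have h2 : w n n = K := by
        simp only [hw]
        rw [card_filter_range_window (Finset.mem_range.1 hn) le_rfl]
        simp
      simp only [hFdef, h2, Complex.mul_conj, Complex.ofReal_re, Complex.normSq_eq_norm_sq]
      exact mul_le_of_le_one_right (Nat.cast_nonneg _) (pow_le_one₀ (norm_nonneg _) (hb n))
    refine (Finset.sum_le_card_nsmul _ _ _ h1).trans (le_of_eq ?_)
    rw [Finset.card_range, nsmul_eq_mul, mul_comm]
  have hoff : ∑ k ∈ Finset.Ico 1 K, ∑ n ∈ Finset.range (N - k), F (n + k) n =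
      ∑ k ∈ Finset.Ico 1 K, ((K - k : ℕ) : ℝ) *
        (∑ n ∈ Finset.range (N - k), b (n + k) * conj (b n)).re := by
    refine Finset.sum_congr rfl fun k _ => ?_
    rw [Complex.re_sum, Finset.mul_sum]
    refine Finset.sum_congr rfl fun n hn => ?_
    rw [Finset.mem_range] at hn
    have h2 : w (n + k) n = (K - k : ℕ) := by
      simp only [hw]
      rw [card_filter_range_window (by omega) (by omega), Nat.add_sub_cancel_left]
    simp only [hFdef, h2]
  rw [hoff] at hexp
  set E := ∑ k ∈ Finset.Ico 1 K, ((K - k : ℕ) : ℝ) *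
        (∑ n ∈ Finset.range (N - k), b (n + k) * conj (b n)).re with hE
  rw [hWsum, norm_mul, Complex.norm_natCast, mul_pow] at hcs
  refine hcs.trans ?_
  have h0 : 0 ≤ ∑ i ∈ Finset.range (N + K), ‖W i‖ ^ 2 :=
    Finset.sum_nonneg fun i _ => by positivity
  have hNK : ((N + K : ℕ) : ℝ) ≤ 2 * N := by
    have : ((N + K : ℕ) : ℝ) ≤ (2 * N : ℕ) := by exact_mod_cast (by omega)
    simpa using this
  refine (mul_le_mul_of_nonneg_right hNK h0).trans ?_
  refine mul_le_mul_of_nonneg_left ?_ (by positivity)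
  rw [hexp]
  linarith

open ComplexConjugate in
theorem sum_mulChar_sum_mul_conj_eq {p : ℕ} [Fact p.Prime] {ι : Type*} (s : Finset ι)
    {u v : ι → ZMod p} (hv : ∀ i ∈ s, v i ≠ 0) :
    ∑ χ : MulChar (ZMod p) ℂ, ∑ i ∈ s, χ (u i) * conj (χ (v i)) =
      ((p : ℂ) - 1) * (s.filter fun i => u i = v i).card := by
  rw [Finset.sum_comm, Finset.card_filter, Nat.cast_sum, Finset.mul_sum]
  refine Finset.sum_congr rfl fun i hi => ?_
  have h1 := DirichletCharacter.sum_char_inv_mul_char_eq ℂ (hv i hi).isUnit (u i)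
  have h2 : ∀ χ : MulChar (ZMod p) ℂ, χ (u i) * conj (χ (v i)) = χ (v i)⁻¹ * χ (u i) := by
    intro χ
    rw [mul_comm, ← MulChar.inv_apply', ← MulChar.star_apply', RCLike.star_def]
  rw [Finset.sum_congr rfl fun χ _ => h2 χ]
  refine h1.trans ?_
  rw [Nat.totient_prime (Fact.out : p.Prime), Nat.cast_sub (Fact.out : p.Prime).one_le]
  by_cases h : u i = v i
  · simp [h]
  · simp [h, Ne.symm h]

/-- The character sum over the factorials of the integers in `(H, H + N]`. -/
noncomputable def factorialSum {p : ℕ} (χ : MulChar (ZMod p) ℂ) (H N : ℕ) : ℂ :=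
  ∑ n ∈ Finset.Icc (H + 1) (H + N), χ (n.factorial : ZMod p)

/-- The number of solutions of the congruence between two products of `ℓ` factorials of integers
in `(H, H + N]`. -/
def factorialCount (p ℓ H N : ℕ) : ℕ :=
  (((Fintype.piFinset fun _ : Fin ℓ => Finset.Icc (H + 1) (H + N)) ×ˢ
    (Fintype.piFinset fun _ : Fin ℓ => Finset.Icc (H + 1) (H + N))).filter
    fun nm => (∏ i, ((nm.1 i).factorial : ZMod p)) = ∏ i, ((nm.2 i).factorial : ZMod p)).card

theorem natCast_factorial_ne_zero {p : ℕ} (hp : p.Prime) {n : ℕ} (hn : n < p) :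
    (n.factorial : ZMod p) ≠ 0 := by
  rw [Ne, ZMod.natCast_eq_zero_iff, hp.dvd_factorial]
  exact not_le.2 hn

theorem prod_factorial_ne_zero {p : ℕ} [Fact p.Prime] {H N ℓ : ℕ} (hHN : H + N < p)
    {x : Fin ℓ → ℕ} (hx : x ∈ Fintype.piFinset fun _ : Fin ℓ => Finset.Icc (H + 1) (H + N)) :
    ∏ i, ((x i).factorial : ZMod p) ≠ 0 := by
  refine Finset.prod_ne_zero_iff.2 fun i _ => natCast_factorial_ne_zero Fact.out ?_
  exact (Finset.mem_Icc.1 (Fintype.mem_piFinset.1 hx i)).2.trans_lt hHN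

theorem factorialSum_pow {p : ℕ} (χ : MulChar (ZMod p) ℂ) (H N ℓ : ℕ) :
    factorialSum χ H N ^ ℓ =
      ∑ x ∈ Fintype.piFinset fun _ : Fin ℓ => Finset.Icc (H + 1) (H + N),
        χ (∏ i, ((x i).factorial : ZMod p)) := by
  rw [factorialSum, Finset.sum_pow']
  exact Finset.sum_congr rfl fun x _ => (map_prod χ _ _).symm

open ComplexConjugate in
theorem norm_factorialSum_pow {p : ℕ} (χ : MulChar (ZMod p) ℂ) (H N ℓ : ℕ) :
    ((‖factorialSum χ H N‖ ^ (2 * ℓ) : ℝ) : ℂ) =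
      ∑ xy ∈ (Fintype.piFinset fun _ : Fin ℓ => Finset.Icc (H + 1) (H + N)) ×ˢ
        (Fintype.piFinset fun _ : Fin ℓ => Finset.Icc (H + 1) (H + N)),
        χ (∏ i, ((xy.1 i).factorial : ZMod p)) * conj (χ (∏ i, ((xy.2 i).factorial : ZMod p))) := by
  rw [Finset.sum_product]
  dsimp only
  rw [← Finset.sum_mul_sum, ← map_sum (starRingEnd ℂ), ← factorialSum_pow, Complex.mul_conj,
    Complex.normSq_eq_norm_sq, norm_pow, ← pow_mul, mul_comm ℓ]

theorem sum_norm_factorialSum_pow {p : ℕ} [Fact p.Prime] {H N : ℕ} (hHN : H + N < p) (ℓ : ℕ) :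
    ∑ χ : MulChar (ZMod p) ℂ, ‖factorialSum χ H N‖ ^ (2 * ℓ) =
      ((p : ℝ) - 1) * factorialCount p ℓ H N := by
  have h1 := sum_mulChar_sum_mul_conj_eq
    ((Fintype.piFinset fun _ : Fin ℓ => Finset.Icc (H + 1) (H + N)) ×ˢ
      (Fintype.piFinset fun _ : Fin ℓ => Finset.Icc (H + 1) (H + N)))
    (u := fun xy => ∏ i, ((xy.1 i).factorial : ZMod p))
    (v := fun xy => ∏ i, ((xy.2 i).factorial : ZMod p))
    fun xy hxy => prod_factorial_ne_zero hHN (Finset.mem_product.1 hxy).2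
  rw [← Finset.sum_congr rfl fun χ _ => norm_factorialSum_pow χ H N ℓ] at h1
  have h2 : ((∑ χ : MulChar (ZMod p) ℂ, ‖factorialSum χ H N‖ ^ (2 * ℓ) : ℝ) : ℂ) =
      ((((p : ℝ) - 1) * factorialCount p ℓ H N : ℝ) : ℂ) := by
    push_cast
    push_cast at h1
    exact h1
  exact_mod_cast h2

theorem card_filter_prod_eq_le {p : ℕ} [Fact p.Prime] {k M a : ℕ} (hk : 1 ≤ k) (hM : M ≤ p)
    (c : ZMod p) :
    ((Finset.range M).filter fun m =>
      ∏ i ∈ Finset.range k, (((a + m : ℕ) : ZMod p) + 1 + i) = c).card ≤ k := by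
  set P : Polynomial (ZMod p) :=
    ∏ i ∈ Finset.range k, (Polynomial.X + Polynomial.C ((1 : ZMod p) + i)) with hP
  have hdeg : P.natDegree = k := by
    rw [hP, Polynomial.natDegree_prod_of_monic _ _ fun i _ => Polynomial.monic_X_add_C _]
    simp only [Polynomial.natDegree_X_add_C, Finset.sum_const, Finset.card_range, smul_eq_mul,
      mul_one]
  have hdeg' : 0 < P.degree := Polynomial.natDegree_pos_iff_degree_pos.1 (by omega)
  have hne : P - Polynomial.C c ≠ 0 := fun h => by
    rw [sub_eq_zero.1 h, Polynomial.natDegree_C] at hdeg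
    omega
  have hinj : Set.InjOn (fun m : ℕ => ((a + m : ℕ) : ZMod p)) (Finset.range M) := by
    intro i hi j hj hij
    rw [Finset.coe_range, Set.mem_Iio] at hi hj
    simp only [Nat.cast_add, add_right_inj] at hij
    have h1 := (ZMod.natCast_eq_natCast_iff' i j p).1 hij
    rwa [Nat.mod_eq_of_lt (hi.trans_le hM), Nat.mod_eq_of_lt (hj.trans_le hM)] at h1
  calc _ ≤ (P - Polynomial.C c).roots.toFinset.card := by
        refine Finset.card_le_card_of_injOn (fun m : ℕ => ((a + m : ℕ) : ZMod p)) ?_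
          (hinj.mono (Finset.coe_subset.2 (Finset.filter_subset _ _)))
        intro m hm
        have hm2 := (Finset.mem_filter.1 hm).2
        rw [Finset.mem_coe, Multiset.mem_toFinset, Polynomial.mem_roots hne, Polynomial.IsRoot.def,
          Polynomial.eval_sub, Polynomial.eval_C, hP, Polynomial.eval_prod, sub_eq_zero, ← hm2]
        refine Finset.prod_congr rfl fun i _ => ?_
        simp only [Polynomial.eval_add, Polynomial.eval_X, Polynomial.eval_C]
        ring
    _ ≤ (P - Polynomial.C c).roots.card := Multiset.toFinset_card_le _
    _ ≤ P.natDegree := Polynomial.card_roots_sub_C' hdeg'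
    _ = k := hdeg

open ComplexConjugate in
theorem sum_re_sum_mul_norm_factorialSum_pow_le {p : ℕ} [Fact p.Prime] {H N : ℕ}
    (hHN : H + N < p) (ℓ : ℕ) {k M a : ℕ} (hk : 1 ≤ k) (hM : M ≤ p) :
    ∑ χ : MulChar (ZMod p) ℂ,
      (∑ m ∈ Finset.range M, χ (∏ i ∈ Finset.range k, (((a + m : ℕ) : ZMod p) + 1 + i))).re *
        ‖factorialSum χ H N‖ ^ (2 * ℓ) ≤ ((p : ℝ) - 1) * (k * N ^ (2 * ℓ)) := by
  set A := (Fintype.piFinset fun _ : Fin ℓ => Finset.Icc (H + 1) (H + N)) with hA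
  have h1 := sum_mulChar_sum_mul_conj_eq ((A ×ˢ A) ×ˢ Finset.range M)
    (u := fun xm => (∏ i ∈ Finset.range k, (((a + xm.2 : ℕ) : ZMod p) + 1 + i)) *
      ∏ i, ((xm.1.1 i).factorial : ZMod p))
    (v := fun xm => ∏ i, ((xm.1.2 i).factorial : ZMod p))
    fun xm hxm => prod_factorial_ne_zero hHN
      (Finset.mem_product.1 (Finset.mem_product.1 hxm).1).2
  have h2 : ∀ χ : MulChar (ZMod p) ℂ,
      (∑ m ∈ Finset.range M, χ (∏ i ∈ Finset.range k, (((a + m : ℕ) : ZMod p) + 1 + i))) *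
        ((‖factorialSum χ H N‖ ^ (2 * ℓ) : ℝ) : ℂ) =
      ∑ xm ∈ (A ×ˢ A) ×ˢ Finset.range M,
        χ ((∏ i ∈ Finset.range k, (((a + xm.2 : ℕ) : ZMod p) + 1 + i)) *
          ∏ i, ((xm.1.1 i).factorial : ZMod p)) *
          conj (χ (∏ i, ((xm.1.2 i).factorial : ZMod p))) := by
    intro χ
    rw [norm_factorialSum_pow, Finset.sum_mul_sum, Finset.sum_comm, Finset.sum_product (A ×ˢ A)]
    refine Finset.sum_congr rfl fun xy _ => ?_
    refine Finset.sum_congr rfl fun m _ => ?_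
    rw [map_mul, mul_assoc]
  rw [← Finset.sum_congr rfl fun χ _ => h2 χ] at h1
  have h3 := congrArg Complex.re h1
  simp only [Complex.re_sum, Complex.re_mul_ofReal] at h3
  simp only [Complex.re_sum]
  rw [h3]
  have hcard : (((A ×ˢ A) ×ˢ Finset.range M).filter fun xm =>
      (∏ i ∈ Finset.range k, (((a + xm.2 : ℕ) : ZMod p) + 1 + i)) *
      ∏ i, ((xm.1.1 i).factorial : ZMod p) =
        ∏ i, ((xm.1.2 i).factorial : ZMod p)).card ≤ k * N ^ (2 * ℓ) := by
    rw [Finset.card_filter, Finset.sum_product]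
    calc _ ≤ ∑ xy ∈ A ×ˢ A, k := by
          refine Finset.sum_le_sum fun xy hxy => ?_
          rw [← Finset.card_filter]
          have hx := prod_factorial_ne_zero hHN (Finset.mem_product.1 hxy).1
          simp only [← eq_div_iff hx]
          exact card_filter_prod_eq_le hk hM _
      _ = k * N ^ (2 * ℓ) := by
          rw [Finset.sum_const, smul_eq_mul, Finset.card_product, hA, Fintype.card_piFinset]
          simp
          ring
  have hp1 : (0 : ℝ) ≤ (p : ℝ) - 1 :=
    sub_nonneg.2 (by exact_mod_cast (Fact.out : p.Prime).one_le)
  have h4 : ∀ c : ℕ, (((p : ℂ) - 1) * c).re = ((p : ℝ) - 1) * c := fun c => by simp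
  rw [h4]
  exact mul_le_mul_of_nonneg_left (by exact_mod_cast hcard) hp1

open ComplexConjugate in
theorem sq_mul_norm_factorialSum_sq_le {p : ℕ} [Fact p.Prime] (χ : MulChar (ZMod p) ℂ)
    {H N K : ℕ} (hHN : H + N < p) (hKN : K ≤ N) :
    (K : ℝ) ^ 2 * ‖factorialSum χ H N‖ ^ 2 ≤
      2 * N * (K * N + 2 * ∑ k ∈ Finset.Ico 1 K, ((K - k : ℕ) : ℝ) *
        (∑ m ∈ Finset.range (N - k),
          χ (∏ i ∈ Finset.range k, (((H + 1 + m : ℕ) : ZMod p) + 1 + i))).re) := by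
  have hS : factorialSum χ H N =
      ∑ n ∈ Finset.range N, χ ((H + 1 + n).factorial : ZMod p) := by
    have : Finset.Icc (H + 1) (H + N) = Finset.Ico (H + 1) (H + 1 + N) := by
      ext; simp only [Finset.mem_Icc, Finset.mem_Ico]; omega
    rw [factorialSum, this, Finset.sum_Ico_eq_sum_range, Nat.add_sub_cancel_left]
  rw [hS]
  refine (vanDerCorput hKN fun n => DirichletCharacter.norm_le_one χ _).trans (le_of_eq ?_)
  congr 3
  refine Finset.sum_congr rfl fun k _ => ?_
  congr 2
  refine Finset.sum_congr rfl fun n hn => ?_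
  have hn' := Finset.mem_range.1 hn
  have h0 := natCast_factorial_ne_zero (Fact.out : p.Prime) (n := H + 1 + n) (by omega)
  rw [← add_assoc, ← Nat.factorial_mul_ascFactorial, Nat.ascFactorial_eq_prod_range, Nat.cast_mul,
    map_mul, mul_right_comm, Complex.mul_conj, Complex.normSq_eq_norm_sq]
  have h1 : ‖χ ((H + 1 + n).factorial : ZMod p)‖ = 1 := by
    have := DirichletCharacter.unit_norm_eq_one χ h0.isUnit.unit
    simpa using this
  rw [h1]
  push_cast
  simp

theorem sum_Ico_sub_mul_le (K : ℕ) :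
    ∑ k ∈ Finset.Ico 1 K, ((K - k : ℕ) : ℝ) * k ≤ (K : ℝ) ^ 3 / 2 := by
  calc ∑ k ∈ Finset.Ico 1 K, ((K - k : ℕ) : ℝ) * k
      ≤ ∑ k ∈ Finset.Ico 1 K, (K : ℝ) ^ 2 / 2 := by
        refine Finset.sum_le_sum fun k hk => ?_
        rw [Nat.cast_sub (Finset.mem_Ico.1 hk).2.le]
        nlinarith [sq_nonneg ((K : ℝ) - k), sq_nonneg (k : ℝ)]
    _ = ((K - 1 : ℕ) : ℝ) * ((K : ℝ) ^ 2 / 2) := by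
        rw [Finset.sum_const, Nat.card_Ico, nsmul_eq_mul]
    _ ≤ (K : ℝ) * ((K : ℝ) ^ 2 / 2) :=
        mul_le_mul_of_nonneg_right (by exact_mod_cast Nat.sub_le K 1) (by positivity)
    _ = _ := by ring

theorem mul_factorialCount_succ_le {p : ℕ} [Fact p.Prime] {H N K : ℕ} (hHN : H + N < p)
    (hK : 1 ≤ K) (hKN : K ≤ N) (ℓ : ℕ) :
    (K : ℝ) * factorialCount p (ℓ + 1) H N ≤
      2 * N ^ 2 * factorialCount p ℓ H N + 2 * K ^ 2 * N ^ (2 * ℓ + 1) := by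
  have hp1 : (0 : ℝ) < (p : ℝ) - 1 :=
    sub_pos.2 (by exact_mod_cast (Fact.out : p.Prime).one_lt)
  have hK0 : (0 : ℝ) < K := by exact_mod_cast hK
  set R : MulChar (ZMod p) ℂ → ℕ → ℝ := fun χ k => (∑ m ∈ Finset.range (N - k),
    χ (∏ i ∈ Finset.range k, (((H + 1 + m : ℕ) : ZMod p) + 1 + i))).re with hR
  have h1 : (K : ℝ) ^ 2 * (((p : ℝ) - 1) * factorialCount p (ℓ + 1) H N) ≤
      2 * N * (K * N * (((p : ℝ) - 1) * factorialCount p ℓ H N) +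
        2 * ∑ k ∈ Finset.Ico 1 K, ((K - k : ℕ) : ℝ) *
          ∑ χ : MulChar (ZMod p) ℂ, R χ k * ‖factorialSum χ H N‖ ^ (2 * ℓ)) := by
    rw [← sum_norm_factorialSum_pow hHN, ← sum_norm_factorialSum_pow hHN, Finset.mul_sum]
    calc _ ≤ ∑ χ : MulChar (ZMod p) ℂ,
          2 * N * (K * N + 2 * ∑ k ∈ Finset.Ico 1 K, ((K - k : ℕ) : ℝ) * R χ k) *
            ‖factorialSum χ H N‖ ^ (2 * ℓ) := by
          refine Finset.sum_le_sum fun χ _ => ?_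
          rw [mul_add 2 ℓ 1, pow_add, mul_one, mul_comm (‖factorialSum χ H N‖ ^ (2 * ℓ)),
            ← mul_assoc]
          exact mul_le_mul_of_nonneg_right (sq_mul_norm_factorialSum_sq_le χ hHN hKN)
            (by positivity)
      _ = _ := by
          simp only [Finset.mul_sum, mul_add, add_mul, Finset.sum_mul, Finset.sum_add_distrib]
          rw [Finset.sum_comm]
          simp only [mul_assoc]
  have h2 : ∑ k ∈ Finset.Ico 1 K, ((K - k : ℕ) : ℝ) *
      ∑ χ : MulChar (ZMod p) ℂ, R χ k * ‖factorialSum χ H N‖ ^ (2 * ℓ) ≤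
      ((p : ℝ) - 1) * N ^ (2 * ℓ) * ((K : ℝ) ^ 3 / 2) := by
    refine le_trans ?_ (mul_le_mul_of_nonneg_left (sum_Ico_sub_mul_le K) (by positivity))
    rw [Finset.mul_sum]
    refine Finset.sum_le_sum fun k hk => ?_
    have h3 := sum_re_sum_mul_norm_factorialSum_pow_le hHN ℓ (Finset.mem_Ico.1 hk).1
      (M := N - k) (a := H + 1) (by omega)
    refine (mul_le_mul_of_nonneg_left h3 (Nat.cast_nonneg _)).trans (le_of_eq ?_)
    ring
  have h4 : ((p : ℝ) - 1) * K * (K * factorialCount p (ℓ + 1) H N) ≤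
      ((p : ℝ) - 1) * K *
        (2 * N ^ 2 * factorialCount p ℓ H N + 2 * K ^ 2 * N ^ (2 * ℓ + 1)) := by
    have h5 : (0 : ℝ) ≤ 2 * N * 2 := by positivity
    have h6 := mul_le_mul_of_nonneg_left h2 h5
    rw [pow_succ (N : ℝ) (2 * ℓ)]
    linarith
  exact le_of_mul_le_mul_left h4 (by positivity)

theorem factorialCount_zero (p H N : ℕ) : factorialCount p 0 H N = 1 := by
  simp [factorialCount]

theorem exists_natCeil_rpow {x : ℝ} (hx : 1 ≤ x) {N : ℕ} (hxN : x ≤ N) :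
    ∃ K : ℕ, 1 ≤ K ∧ K ≤ N ∧ x ≤ K ∧ (K : ℝ) ≤ 2 * x := by
  refine ⟨⌈x⌉₊, Nat.one_le_ceil_iff.2 (by linarith), Nat.ceil_le.2 hxN, Nat.le_ceil x, ?_⟩
  have := Nat.ceil_lt_add_one (zero_le_one.trans hx)
  linarith

theorem exists_factorialCount_le (ℓ : ℕ) : ∃ C : ℝ, 0 < C ∧ ∀ p : ℕ, p.Prime → ∀ H N : ℕ,
    0 < N → H + N < p →
      (factorialCount p ℓ H N : ℝ) ≤ C * (N : ℝ) ^ (2 * (ℓ : ℝ) - 1 + 2 ^ (-(ℓ : ℝ))) := by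
  induction ℓ with
  | zero =>
    refine ⟨1, one_pos, fun p _ H N _ _ => ?_⟩
    simp [factorialCount_zero]
  | succ ℓ ih =>
    obtain ⟨C, hC, ih⟩ := ih
    refine ⟨2 * C + 4, by positivity, fun p hp H N hN hHN => ?_⟩
    have : Fact p.Prime := ⟨hp⟩
    have hN1 : (1 : ℝ) ≤ N := by exact_mod_cast hN
    have hN0 : (0 : ℝ) < N := by linarith
    set s : ℝ := 2 ^ (-((ℓ + 1 : ℕ) : ℝ)) with hs
    have hs0 : 0 ≤ s := by positivity
    have hs1 : s ≤ 1 := Real.rpow_le_one_of_one_le_of_nonpos one_le_two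
      (neg_nonpos.2 (Nat.cast_nonneg _))
    have hs2 : (2 : ℝ) ^ (-(ℓ : ℝ)) = s + s := by
      have : (-(ℓ : ℝ)) = -((ℓ + 1 : ℕ) : ℝ) + 1 := by push_cast; ring
      rw [this, Real.rpow_add_one two_ne_zero, mul_two]
    obtain ⟨K, hK1, hKN, hxK, hKx⟩ := exists_natCeil_rpow (Real.one_le_rpow hN1 hs0)
      (Real.rpow_le_self_of_one_le hN1 hs1)
    set x : ℝ := (N : ℝ) ^ s with hx
    have hx0 : 0 < x := Real.rpow_pos_of_pos hN0 _
    have h1 := mul_factorialCount_succ_le hHN hK1 hKN ℓ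
    have h2 := ih p hp H N hN hHN
    have h3 : (N : ℝ) ^ 2 * (N : ℝ) ^ (2 * (ℓ : ℝ) - 1 + 2 ^ (-(ℓ : ℝ))) =
        (N : ℝ) ^ (2 * ℓ + 1) * (x * x) := by
      rw [hs2, hx, ← Real.rpow_natCast, ← Real.rpow_natCast, ← Real.rpow_add hN0,
        ← Real.rpow_add hN0, ← Real.rpow_add hN0]
      congr 1
      push_cast
      ring
    have h4 : (N : ℝ) ^ (2 * ((ℓ + 1 : ℕ) : ℝ) - 1 + s) = (N : ℝ) ^ (2 * ℓ + 1) * x := by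
      rw [hx, ← Real.rpow_natCast, ← Real.rpow_add hN0]
      congr 1
      push_cast
      ring
    rw [h4]
    set y : ℝ := (N : ℝ) ^ (2 * ℓ + 1) with hy
    have hy0 : 0 < y := by positivity
    have hK0 : (0 : ℝ) < K := by exact_mod_cast hK1
    refine le_of_mul_le_mul_left (h1.trans ?_) hK0
    have h5 : 2 * (N : ℝ) ^ 2 * factorialCount p ℓ H N ≤ K * (2 * C * (y * x)) := by
      calc _ ≤ 2 * (N : ℝ) ^ 2 * (C * (N : ℝ) ^ (2 * (ℓ : ℝ) - 1 + 2 ^ (-(ℓ : ℝ)))) :=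
            mul_le_mul_of_nonneg_left h2 (by positivity)
        _ = x * (2 * C * (y * x)) := by linear_combination 2 * C * h3
        _ ≤ _ := mul_le_mul_of_nonneg_right hxK (by positivity)
    have h6 : 2 * (K : ℝ) ^ 2 * y ≤ K * (4 * (y * x)) := by
      calc 2 * (K : ℝ) ^ 2 * y = 2 * K * y * K := by ring
        _ ≤ 2 * K * y * (2 * x) := mul_le_mul_of_nonneg_left hKx (by positivity)
        _ = _ := by ring
    linarith

theorem norm_factorialSum_le {p : ℕ} [Fact p.Prime] (χ : MulChar (ZMod p) ℂ) (H N : ℕ) :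
    ‖factorialSum χ H N‖ ≤ N := by
  refine (norm_sum_le_of_le _ fun n _ => DirichletCharacter.norm_le_one χ _).trans ?_
  simp

theorem norm_factorialSum_sq_le {p : ℕ} [Fact p.Prime] (hp3 : 3 ≤ p) {χ : MulChar (ZMod p) ℂ}
    (hχ : χ ≠ 1) {H N : ℕ} (hHN : H + N < p) :
    ‖factorialSum χ H N‖ ^ 2 ≤ 14 * (N * √(N * (√p * Real.log p))) := by
  have hL0 : 0 < √(p : ℝ) * Real.log p := by
    have h3 : (3 : ℝ) ≤ p := by exact_mod_cast hp3
    have := Real.log_pos (show (1 : ℝ) < p by linarith)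
    positivity
  have hL1 : 1 ≤ √(p : ℝ) * Real.log p := by
    have h3 : (3 : ℝ) ≤ p := by exact_mod_cast hp3
    have h4 : 1 ≤ √(p : ℝ) := Real.one_le_sqrt.2 (by linarith)
    have h5 : 1 ≤ Real.log p := by
      rw [Real.le_log_iff_exp_le (by linarith)]
      exact Real.exp_one_lt_three.le.trans h3
    exact one_le_mul_of_one_le_of_one_le h4 h5
  have hcorr : ∀ k ∈ Finset.Ico 1 (N + 1), (∑ m ∈ Finset.range (N - k),
      χ (∏ i ∈ Finset.range k, (((H + 1 + m : ℕ) : ZMod p) + 1 + i))).re ≤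
        3 * k * (√p * Real.log p) := by
    intro k hk
    obtain ⟨hk1, hk2⟩ := Finset.mem_Ico.1 hk
    rw [← mul_assoc]
    exact (Complex.re_le_norm _).trans
      (norm_sum_range_mulChar_prod_le hp3 hχ hk1 (by omega) _ (by omega))
  set L : ℝ := √(p : ℝ) * Real.log p with hL
  have hN0 : (0 : ℝ) ≤ N := Nat.cast_nonneg N
  rcases le_or_gt (N : ℝ) L with hNL | hNL
  · calc ‖factorialSum χ H N‖ ^ 2 ≤ (N : ℝ) ^ 2 :=
          pow_le_pow_left₀ (norm_nonneg _) (norm_factorialSum_le χ H N) 2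
      _ = N * √(N * N) := by rw [Real.sqrt_mul_self hN0, sq]
      _ ≤ N * √(N * L) := by gcongr
      _ ≤ 14 * (N * √(N * L)) := by
          have : 0 ≤ N * √(N * L) := by positivity
          linarith
  · set t : ℝ := √(N / L) with ht
    have htt : t * t * L = N := by
      rw [ht, Real.mul_self_sqrt (by positivity), div_mul_cancel₀ _ hL0.ne']
    have ht1 : 1 ≤ t := Real.one_le_sqrt.2 ((one_le_div hL0).2 hNL.le)
    have htN : t ≤ N := by
      rw [← htt]
      nlinarith [mul_le_mul ht1 hL1 zero_le_one (by linarith)]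
    have htL : √(N * L) = t * L := by
      rw [← htt, show t * t * L * L = (t * L) * (t * L) by ring]
      exact Real.sqrt_mul_self (by positivity)
    obtain ⟨K, hK1, hKN, htK, hKt⟩ := exists_natCeil_rpow ht1 htN
    have hK0 : (0 : ℝ) < K := by exact_mod_cast hK1
    have h1 := sq_mul_norm_factorialSum_sq_le χ hHN hKN
    have h2 : ∑ k ∈ Finset.Ico 1 K, ((K - k : ℕ) : ℝ) * (∑ m ∈ Finset.range (N - k),
        χ (∏ i ∈ Finset.range k, (((H + 1 + m : ℕ) : ZMod p) + 1 + i))).re ≤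
        3 * L * ((K : ℝ) ^ 3 / 2) := by
      refine le_trans ?_ (mul_le_mul_of_nonneg_left (sum_Ico_sub_mul_le K) (by positivity))
      rw [Finset.mul_sum]
      refine Finset.sum_le_sum fun k hk => ?_
      have hk' := Finset.mem_Ico.1 hk
      refine (mul_le_mul_of_nonneg_left (hcorr k (Finset.mem_Ico.2 ⟨hk'.1, by omega⟩))
        (Nat.cast_nonneg _)).trans (le_of_eq ?_)
      ring
    have h3 : (K : ℝ) ^ 2 * ‖factorialSum χ H N‖ ^ 2 ≤
        K ^ 2 * (14 * (N * √(N * L))) := by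
      rw [htL]
      have h4 : (N : ℝ) * N * K ≤ N * (t * L) * (K * K) := by
        calc (N : ℝ) * N * K = N * (t * L) * (K * t) := by rw [← htt]; ring
          _ ≤ N * (t * L) * (K * K) := by gcongr
      have h5 : (K : ℝ) ^ 3 * (N * L) ≤ 2 * (N * (t * L)) * (K * K) := by
        calc (K : ℝ) ^ 3 * (N * L) = K * K * (N * L) * K := by ring
          _ ≤ K * K * (N * L) * (2 * t) := by gcongr
          _ = _ := by ring
      have h6 := mul_le_mul_of_nonneg_left h2 (show (0 : ℝ) ≤ 2 * N * 2 by positivity)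
      linarith
    exact le_of_mul_le_mul_left h3 (by positivity)

theorem factorialSum_one {p : ℕ} [Fact p.Prime] {H N : ℕ} (hHN : H + N < p) :
    factorialSum (1 : MulChar (ZMod p) ℂ) H N = N := by
  rw [factorialSum, Finset.sum_congr rfl fun n hn => MulChar.one_apply
    (natCast_factorial_ne_zero Fact.out ((Finset.mem_Icc.1 hn).2.trans_lt hHN)).isUnit]
  simp

theorem abs_factorialCount_sub_le {p : ℕ} [Fact p.Prime] (hp3 : 3 ≤ p) {H N : ℕ}
    (hHN : H + N < p) (m r : ℕ) :
    |(factorialCount p (m + r) H N : ℝ) - (N : ℝ) ^ (2 * (m + r)) / ((p : ℝ) - 1)| ≤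
      (14 * (N * √(N * (√p * Real.log p)))) ^ m * factorialCount p r H N := by
  classical
  have hp1 : (0 : ℝ) < (p : ℝ) - 1 :=
    sub_pos.2 (by exact_mod_cast (Fact.out : p.Prime).one_lt)
  have h1 : ((p : ℝ) - 1) * factorialCount p (m + r) H N - (N : ℝ) ^ (2 * (m + r)) =
      ∑ χ ∈ Finset.univ.erase (1 : MulChar (ZMod p) ℂ),
        ‖factorialSum χ H N‖ ^ (2 * (m + r)) := by
    rw [← sum_norm_factorialSum_pow hHN,
      ← Finset.add_sum_erase _ _ (Finset.mem_univ (1 : MulChar (ZMod p) ℂ)),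
      factorialSum_one hHN, Complex.norm_natCast, add_sub_cancel_left]
  have h2 : ∑ χ ∈ Finset.univ.erase (1 : MulChar (ZMod p) ℂ),
      ‖factorialSum χ H N‖ ^ (2 * (m + r)) ≤
        (14 * (N * √(N * (√p * Real.log p)))) ^ m *
          (((p : ℝ) - 1) * factorialCount p r H N) := by
    rw [← sum_norm_factorialSum_pow hHN, Finset.mul_sum]
    have hlog : 0 ≤ Real.log p := Real.log_natCast_nonneg p
    refine le_trans (Finset.sum_le_sum fun χ hχ => ?_)
      (Finset.sum_le_sum_of_subset_of_nonneg (Finset.erase_subset _ _)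
        fun χ _ _ => by positivity)
    rw [mul_add, pow_add, pow_mul]
    exact mul_le_mul_of_nonneg_right (pow_le_pow_left₀ (by positivity)
      (norm_factorialSum_sq_le hp3 (Finset.ne_of_mem_erase hχ) hHN) m) (by positivity)
  have h3 : (factorialCount p (m + r) H N : ℝ) - (N : ℝ) ^ (2 * (m + r)) / ((p : ℝ) - 1) =
      (∑ χ ∈ Finset.univ.erase (1 : MulChar (ZMod p) ℂ),
        ‖factorialSum χ H N‖ ^ (2 * (m + r))) / ((p : ℝ) - 1) := by
    rw [← h1]
    field_simp
  rw [h3, abs_of_nonneg (div_nonneg (Finset.sum_nonneg fun χ _ => by positivity) hp1.le),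
    div_le_iff₀ hp1]
  linarith

theorem sqrt_mul_sqrt_mul_log_pow {N p : ℝ} (hN : 0 < N) (hp : 1 ≤ p) (m : ℕ) :
    (N * √(N * (√p * Real.log p))) ^ m =
      N ^ (3 * (m : ℝ) / 2) * p ^ ((m : ℝ) / 4) * Real.log p ^ ((m : ℝ) / 2) := by
  have hp0 : 0 ≤ p := by linarith
  have hlog : 0 ≤ Real.log p := Real.log_nonneg hp
  rw [← Real.rpow_natCast, Real.sqrt_eq_rpow, Real.sqrt_eq_rpow,
    Real.mul_rpow hN.le (by positivity), Real.mul_rpow hN.le (by positivity),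
    Real.mul_rpow (by positivity) (by positivity), Real.mul_rpow (by positivity) hlog,
    Real.mul_rpow (by positivity) (by positivity), ← Real.rpow_mul hN.le, ← Real.rpow_mul hp0,
    ← Real.rpow_mul hp0, ← Real.rpow_mul hlog, ← mul_assoc, ← mul_assoc, ← Real.rpow_add hN]
  ring_nf

/-- Theorem 6 (asymptotic formula for `I_ℓ(H,N)`): for fixed `ℓ ≥ r ≥ 1`,
`|I_ℓ(H,N) - N^{2ℓ}/(p-1)| ≤ C N^{3ℓ/2 + r/2 - 1 + 2^{-r}} p^{(ℓ-r)/4} (log p)^{(ℓ-r)/2}`. -/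
theorem count_factorial_product_congruence_asymptotic (ℓ r : ℕ) (hr : 1 ≤ r) (hℓr : r ≤ ℓ) :
    ∃ C : ℝ, 0 < C ∧ ∀ p : ℕ, p.Prime → Odd p →
      ∀ H N : ℕ, 0 < N → H + N < p →
        |((((Fintype.piFinset fun _ : Fin ℓ => Finset.Icc (H + 1) (H + N)) ×ˢ
              (Fintype.piFinset fun _ : Fin ℓ => Finset.Icc (H + 1) (H + N))).filter
            fun nm => (∏ i, ((nm.1 i).factorial : ZMod p)) =
              ∏ i, ((nm.2 i).factorial : ZMod p)).card : ℝ) -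
            (N : ℝ) ^ (2 * ℓ) / ((p : ℝ) - 1)| ≤
          C * (N : ℝ) ^ (3 * (ℓ : ℝ) / 2 + (r : ℝ) / 2 - 1 + 2 ^ (-(r : ℝ))) *
            (p : ℝ) ^ (((ℓ : ℝ) - r) / 4) * (Real.log p) ^ (((ℓ : ℝ) - r) / 2) := by
  obtain ⟨m, rfl⟩ := Nat.exists_eq_add_of_le' hℓr
  obtain ⟨C, hC, hbound⟩ := exists_factorialCount_le r
  refine ⟨14 ^ m * C, by positivity, fun p hp hodd H N hN hHN => ?_⟩
  have : Fact p.Prime := ⟨hp⟩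
  have hp3 : 3 ≤ p := by
    obtain ⟨j, hj⟩ := hodd
    have := hp.two_le
    omega
  have hN0 : (0 : ℝ) < N := by exact_mod_cast hN
  have hlog : 0 ≤ Real.log p := Real.log_natCast_nonneg p
  refine (abs_factorialCount_sub_le hp3 hHN m r).trans ?_
  refine (mul_le_mul_of_nonneg_left (hbound p hp H N hN hHN) (by positivity)).trans
    (le_of_eq ?_)
  have hexp : (N : ℝ) ^ (3 * ((m + r : ℕ) : ℝ) / 2 + (r : ℝ) / 2 - 1 + 2 ^ (-(r : ℝ))) =
      (N : ℝ) ^ (3 * (m : ℝ) / 2) * (N : ℝ) ^ (2 * (r : ℝ) - 1 + 2 ^ (-(r : ℝ))) := by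
    rw [← Real.rpow_add hN0]
    congr 1
    push_cast
    ring
  have hm : ((m + r : ℕ) : ℝ) - r = m := by push_cast; ring
  rw [hexp, hm, mul_pow, sqrt_mul_sqrt_mul_log_pow hN0 (by exact_mod_cast hp.one_le)]
  ring
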